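/- Let $m,n$ be positive integers, $[n]=\{1,\dots,n\}$, and $[a;b]=\{k\in\mathbb Z: a\le k\le b\}$. Let $$\mathrm{Shi}_m^n=\bigl\{\{x\in\mathbb R^n: x_i-x_j=s\} : 1\le i<j\le n,\ s\in[-m+1;m]\bigr\}$$ be the $m$-Shi arrangement of hyperplanes in $\mathbb R^n$. A face of a hyperplane arrangement $\mathcal A$ is a nonempty set $\bigcap_{H\in\mathcal A}\sigma_H$, where each $\sigma_H$ is either $H$ or one of the two open half-spaces bounded by $H$; its codimension is the codimension of its affine hull. **Trees.** An $(m,n)$-tree is a rooted $(m+1)$-ary tree with $n$ internal nodes labeled bijectively by $[n]$ (nodes are identified with their labels; leaves are unlabeled). The children of a node $j$ are denoted $0\text{-child}(j),\dots,m\text{-child}(j)$. A node $i$ is the $s$-cadet of the node $j$ if $i=s\text{-child}(j)$ and $t\text{-child}(j)$ is a leaf for all $t\in[s+1;m]$; then $\{i,j\}$ is a cadet edge. For a vertex $v$ (node or leaf) of $T$, with root-to-$v$ path $v_0,\dots,v_k=v$ and $v_p=s_p\text{-child}(v_{p-1})$, put $\mathrm{path}_T(v)=(s_1,\dots,s_k)$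 and $\mathrm{drift}_T(v)=s_1+\dots+s_k$. The total order $\preceq_T$ on the vertices of $T$ is defined as follows: for distinct vertices $v,w$ with $\mathrm{path}_T(v)=(s_1,\dots,s_k)$ and $\mathrm{path}_T(w)=(t_1,\dots,t_\ell)$, one has $v\prec_T w$ if and only if either $\mathrm{drift}_T(v)<\mathrm{drift}_T(w)$, or $\mathrm{drift}_T(v)=\mathrm{drift}_T(w)$ and there is $p\le \min(k,\ell)$ with $(s_1,\dots,s_p)=(t_1,\dots,t_p)$ and either $p=k$, or $p<\min(k,\ell)$ and $s_{p+1}>t_{p+1}$. **Marked trees.** A marked $(m,n)$-tree is a pair $(T,\mu)$, where $T$ is an $(m,n)$-tree and $\mu$ is a set of cadet edges of $T$ (the marked edges) such that $j<i$ whenever $\{i,j\}\in\mu$ and $i$ is the $0$-cadet of $j$. Let $\overline{\mathcal T}_m^n$ be the set of marked $(m,n)$-trees. Write $i\sim_\mu j$ if all edges on the path of $T$ between the nodes $i$ and $j$ are marked (in particular $i\sim_\mu i$); the classes of $\sim_\mu$ are called blocks. Let $\mathcal A=\mathrm{Shi}_m^n$. Let $\overline{\mathcal T}_m^n(\mathcal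 A)$ be the set of $(T,\mu)\in\overline{\mathcal T}_m^n$ such that * for every block $B$, the graph with vertex set $B$ and an edge $\{i,j\}$ whenever $\{x_i-x_j=\mathrm{drift}_T(i)-\mathrm{drift}_T(j)\}\in\mathcal A$ is connected; and * for every non-marked cadet edge $\{i,j\}$, with $i$ the $s$-cadet of $j$, either $s=0$ and $i<j$, or there are $i'\sim_\mu i$ and $j'\sim_\mu j$ with $\{x_{i'}-x_{j'}=\mathrm{drift}_T(i')-\mathrm{drift}_T(j')\}\in\mathcal A$. Let $\mathrm{Tr}(\mathcal A)$ be the set of triples $(i,j,s)$ with $i,j\in[n]$, $i\neq j$, $s\in[0;m]$, ($s>0$ or $i>j$), and $\{x_i-x_j=s\}\in\mathcal A$. For $(T,\mu)\in\overline{\mathcal T}_m^n$ let $\overline\Phi_{\mathcal A}(T,\mu)$ be the set of all $x\in\mathbb R^n$ such that * $x_i-x_j=s$ for every marked edge $\{i,j\}\in\mu$ with $i=s\text{-child}(j)$; and * for every $(i,j,s)\in\mathrm{Tr}(\mathcal A)$ with $i\not\sim_\mu j$: $x_i-x_j<s$ if $i\prec_T s\text{-child}(j)$, and $x_i-x_j>s$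 if $i\succeq_T s\text{-child}(j)$. **Theorem.** The set $\overline{\mathcal T}_m^n(\mathrm{Shi}_m^n)$ equals the set of marked $(m,n)$-trees $(T,\mu)$ such that, for all nodes $i,j\in[n]$ of $T$, if $i=m\text{-child}(j)$ then $i<j$. Moreover, for each integer $k\ge 0$, the map $\overline\Phi_{\mathrm{Shi}_m^n}$ is a bijection from the set of marked $(m,n)$-trees $(T,\mu)$ satisfying this condition and having exactly $k$ marked edges onto the set of faces of codimension $k$ of $\mathrm{Shi}_m^n$. -/

import Mathlib

namespace Braid

/-- The hyperplane `{x ∈ ℝ^n | x i - x j = s}`. -/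
def hyp (n : ℕ) (i j : Fin n) (s : ℝ) : Set (Fin n → ℝ) := {x | x i - x j = s}

/-- The arrangement `A_S^n`, as a set of hyperplanes. -/
def arrS (S : Set ℤ) (n : ℕ) : Set (Set (Fin n → ℝ)) :=
  {H | ∃ i j : Fin n, ∃ s : ℤ, i < j ∧ s ∈ S ∧ H = hyp n i j (s : ℝ)}

/-- The `m`-Shi arrangement `Shi_m^n = A_{[-m+1;m]}^n`. -/
def shiArr (m n : ℕ) : Set (Set (Fin n → ℝ)) :=
  arrS (Set.Icc (-(m : ℤ) + 1) (m : ℤ)) n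

/-- `(i,j,s) ∈ Tr_m^n`. -/
def TrIdx (m n : ℕ) (i j : Fin n) (s : ℕ) : Prop := s ≤ m ∧ i ≠ j ∧ (0 < s ∨ j < i)

/-- `(i,j,s) ∈ Tr_m^n(A)`. -/
def TrIdxA (m n : ℕ) (A : Set (Set (Fin n → ℝ))) (i j : Fin n) (s : ℕ) : Prop :=
  TrIdx m n i j s ∧ hyp n i j (s : ℝ) ∈ A

/-- An `(m,n)`-tree: a rooted `(m+1)`-ary tree with `n` internal nodes labeled bijectively by
`Fin n` (leaves unlabeled). It is encoded by `path v`, the list of child indices (in `{0,…,m}`)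
read from the root to the node `v`; the paths of the nodes are distinct and closed under
taking the parent. Every other vertex is a leaf, at a path `path j ++ [s]` with `s ≤ m` that is
not the path of a node. -/
@[ext]
structure LTree (m n : ℕ) where
  path : Fin n → List ℕ
  entry_le : ∀ v : Fin n, ∀ s ∈ path v, s ≤ m
  inj : Function.Injective path
  parent_closed : ∀ v : Fin n, path v ≠ [] → ∃ w : Fin n, path w = (path v).dropLast

namespace LTree

variable {m n : ℕ}

/-- The drift of a node. -/
def drift (T : LTree m n) (v : Fin n) : ℕ := (T.path v).sum

/-- `i = s`-child`(j)`. -/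
def IsChild (T : LTree m n) (i j : Fin n) (s : ℕ) : Prop := T.path i = T.path j ++ [s]

/-- `i = s`-cadet`(j)`: `i = s`-child`(j)` and `t`-child`(j)` is a leaf for all `t ∈ [s+1;m]`. -/
def IsCadet (T : LTree m n) (i j : Fin n) (s : ℕ) : Prop :=
  T.IsChild i j s ∧ ∀ t : ℕ, s < t → t ≤ m → ¬ ∃ i', T.IsChild i' j t

end LTree

/-- The strict order `≺_T` on the vertices (nodes and leaves) of a tree, expressed on
root-to-vertex paths: distinct vertices `v`, `w` with paths `p`, `q` satisfy `v ≺_T w` iff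
`drift v < drift w`, or the drifts are equal and for some `c ≤ p.length` the first `c` entries
of both paths agree and (`c = p.length` or the next entry of `p` exceeds that of `q`). -/
def vlt (p q : List ℕ) : Prop :=
  p ≠ q ∧
    (p.sum < q.sum ∨
      (p.sum = q.sum ∧ ∃ c ≤ p.length, p.take c = q.take c ∧
        (c = p.length ∨ ∃ (h1 : c < p.length) (h2 : c < q.length), q[c] < p[c])))

/-- `v ≽_T w`, expressed on root-to-vertex paths. -/
def vge (p q : List ℕ) : Prop := vlt q p ∨ p = q

/-- `(T,μ)` is a marked tree. An edge of `T` is recorded by its lower endpoint (the child), so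
`μ` is the set of the lower endpoints of the marked edges. Each marked edge is a cadet edge, and
a marked edge `{j, 0-cadet(j)}` satisfies `j < 0-cadet(j)`. -/
def IsMarking {m n : ℕ} (T : LTree m n) (μ : Set (Fin n)) : Prop :=
  ∀ i ∈ μ, ∃ j s, T.IsCadet i j s ∧ (s = 0 → j < i)

/-- The relation `i ∼_μ j`: `i` and `j` are joined in `T` by a path of marked edges. -/
def simMu {m n : ℕ} (T : LTree m n) (μ : Set (Fin n)) : Fin n → Fin n → Prop :=
  Relation.ReflTransGen (fun a b =>
    (a ∈ μ ∧ ∃ s, T.IsChild a b s) ∨ (b ∈ μ ∧ ∃ s, T.IsChild b a s))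

/-- The set of blocks (classes of `∼_μ`) of a marked tree. -/
def blocksOf {m n : ℕ} (T : LTree m n) (μ : Set (Fin n)) : Set (Set (Fin n)) :=
  {B | ∃ i, B = {j | simMu T μ i j}}

/-- The block `B` is `A`-connected. -/
def BlockConnected {m n : ℕ} (A : Set (Set (Fin n → ℝ))) (T : LTree m n)
    (B : Set (Fin n)) : Prop :=
  ∀ i ∈ B, ∀ j ∈ B, Relation.ReflTransGen
    (fun a b => a ∈ B ∧ b ∈ B ∧ hyp n a b ((T.drift a : ℝ) - (T.drift b : ℝ)) ∈ A) i j

/-- The marked tree `(T,μ)` is `A`-connected. -/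
def AConnected {m n : ℕ} (A : Set (Set (Fin n → ℝ))) (T : LTree m n)
    (μ : Set (Fin n)) : Prop :=
  ∀ B ∈ blocksOf T μ, BlockConnected A T B

/-- The `A`-cadet condition. -/
def CadetCond {m n : ℕ} (A : Set (Set (Fin n → ℝ))) (T : LTree m n)
    (μ : Set (Fin n)) : Prop :=
  ∀ i j s, T.IsCadet i j s → i ∉ μ →
    ((s = 0 ∧ i < j) ∨
      ∃ i' j', simMu T μ i' i ∧ simMu T μ j' j ∧
        hyp n i' j' ((T.drift i' : ℝ) - (T.drift j' : ℝ)) ∈ A)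

/-- The set `ŌT_m^n` of all marked `(m,n)`-trees. -/
def OTall (m n : ℕ) : Set (LTree m n × Set (Fin n)) := {p | IsMarking p.1 p.2}

/-- The set `ŌT_m^n(A)`. -/
def OTset (m n : ℕ) (A : Set (Set (Fin n → ℝ))) : Set (LTree m n × Set (Fin n)) :=
  {p ∈ OTall m n | AConnected A p.1 p.2 ∧ CadetCond A p.1 p.2}

/-- The polyhedron `Φ̄_A(T,μ)`; the path of the vertex `s`-child`(j)` is `path j ++ [s]`. -/
def PhiBar (m n : ℕ) (A : Set (Set (Fin n → ℝ))) (T : LTree m n) (μ : Set (Fin n)) :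
    Set (Fin n → ℝ) :=
  {x | (∀ i ∈ μ, ∀ j s, T.IsChild i j s → x i - x j = (s : ℝ)) ∧
       ∀ i j : Fin n, ∀ s : ℕ, TrIdxA m n A i j s → ¬ simMu T μ i j →
         (vlt (T.path i) (T.path j ++ [s]) → x i - x j < (s : ℝ)) ∧
         (vge (T.path i) (T.path j ++ [s]) → (s : ℝ) < x i - x j)}

/-- `σ` is the hyperplane `H` itself or one of the two open half-spaces bounded by `H`. -/
def IsSideOf (n : ℕ) (σ H : Set (Fin n → ℝ)) : Prop :=
  σ = H ∨ ∃ (i j : Fin n) (s : ℝ), H = hyp n i j s ∧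
    (σ = {x | x i - x j < s} ∨ σ = {x | s < x i - x j})

/-- `F` is a face of the arrangement `A`. -/
def IsFace (n : ℕ) (A : Set (Set (Fin n → ℝ))) (F : Set (Fin n → ℝ)) : Prop :=
  F.Nonempty ∧ ∃ σ : Set (Fin n → ℝ) → Set (Fin n → ℝ),
    (∀ H ∈ A, IsSideOf n (σ H) H) ∧ F = ⋂ H ∈ A, σ H

/-- The codimension of (the affine hull of) a nonempty subset of `ℝ^n`. -/
noncomputable def codim (n : ℕ) (F : Set (Fin n → ℝ)) : ℕ :=
  Module.finrank ℝ ((Fin n → ℝ) ⧸ (affineSpan ℝ F).direction)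

end Braid

namespace Braid

/-- Depth-first order on root-to-vertex paths: ancestors come first, and the children of a node
are visited by decreasing index. -/
abbrev dfsLt : List ℕ → List ℕ → Prop := List.Lex (fun a b : ℕ => b < a)

theorem dfsLt_cons_cons {a b : ℕ} {p q : List ℕ} :
    dfsLt (a :: p) (b :: q) ↔ b < a ∨ (a = b ∧ dfsLt p q) := by
  constructor
  · intro h
    cases h with
    | cons h => exact Or.inr ⟨rfl, h⟩
    | rel h => exact Or.inl h
  · rintro (h | ⟨rfl, h⟩)
    · exact List.Lex.rel h
    · exact List.Lex.cons h

theorem not_dfsLt_nil {p : List ℕ} : ¬ dfsLt p [] := by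
  intro h; cases h

theorem dfsLt_nil_iff {p : List ℕ} : dfsLt [] p ↔ p ≠ [] := by
  cases p with
  | nil => simp
  | cons a p => simp only [ne_eq, reduceCtorEq, not_false_eq_true, iff_true]; exact List.Lex.nil

theorem dfsLt_append {p r : List ℕ} (hr : r ≠ []) : dfsLt p (p ++ r) := by
  induction p with
  | nil => exact dfsLt_nil_iff.2 hr
  | cons a p ih => exact List.Lex.cons ih

theorem dfsLt_irrefl (p : List ℕ) : ¬ dfsLt p p := by
  induction p with
  | nil => exact not_dfsLt_nil
  | cons a p ih => rw [dfsLt_cons_cons]; rintro (h | ⟨-, h⟩); exacts [lt_irrefl _ h, ih h]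

theorem dfsLt_trans {p q r : List ℕ} (h : dfsLt p q) (h' : dfsLt q r) : dfsLt p r := by
  induction p generalizing q r with
  | nil =>
    cases r with
    | nil => exact absurd h' not_dfsLt_nil
    | cons a r => exact List.Lex.nil
  | cons a p ih =>
    cases q with
    | nil => exact absurd h not_dfsLt_nil
    | cons b q =>
      cases r with
      | nil => exact absurd h' not_dfsLt_nil
      | cons c r =>
        rw [dfsLt_cons_cons] at h h' ⊢
        rcases h with h | ⟨rfl, h⟩ <;> rcases h' with h' | ⟨rfl, h'⟩
        · exact Or.inl (h'.trans h)
        · exact Or.inl h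
        · exact Or.inl h'
        · exact Or.inr ⟨rfl, ih h h'⟩

theorem dfsLt_trichotomy (p q : List ℕ) : dfsLt p q ∨ p = q ∨ dfsLt q p := by
  induction p generalizing q with
  | nil =>
    cases q with
    | nil => simp
    | cons a q => exact Or.inl List.Lex.nil
  | cons a p ih =>
    cases q with
    | nil => exact Or.inr (Or.inr List.Lex.nil)
    | cons b q =>
      simp only [dfsLt_cons_cons, List.cons.injEq]
      rcases lt_trichotomy a b with h | rfl | h
      · exact Or.inr (Or.inr (Or.inl h))
      · rcases ih q with h | h | h <;> simp [h]
      · exact Or.inl (Or.inl h)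

theorem dfsLt_iff_exists_take (p q : List ℕ) :
    dfsLt p q ↔ p ≠ q ∧ ∃ c ≤ p.length, p.take c = q.take c ∧
        (c = p.length ∨ ∃ (h1 : c < p.length) (h2 : c < q.length), q[c] < p[c]) := by
  induction p generalizing q with
  | nil =>
    rw [dfsLt_nil_iff]
    constructor
    · intro h
      exact ⟨h.symm, 0, le_rfl, by simp, Or.inl rfl⟩
    · rintro ⟨h, -⟩
      exact h.symm
  | cons a p ih =>
    cases q with
    | nil =>
      simp only [not_dfsLt_nil, false_iff, not_and, not_exists]
      intro _ c _ hc
      cases c with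
      | zero => simp
      | succ c => simp at hc
    | cons b q =>
      rw [dfsLt_cons_cons, ih]
      constructor
      · rintro (h | ⟨rfl, hne, c, hc, ht, h⟩)
        · refine ⟨fun e => ?_, 0, Nat.zero_le _, by simp, Or.inr ⟨by simp, by simp, by simpa⟩⟩
          simp only [List.cons.injEq] at e
          omega
        · refine ⟨by simpa using hne, c + 1, by simpa using hc, by simpa using ht, ?_⟩
          rcases h with h | ⟨h1, h2, h⟩
          · exact Or.inl (by simpa using h)
          · exact Or.inr ⟨by simpa using h1, by simpa using h2, by simpa using h⟩
      · rintro ⟨hne, c, hc, ht, h⟩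
        cases c with
        | zero =>
          rcases h with h | ⟨h1, h2, h⟩
          · simp at h
          · exact Or.inl (by simpa using h)
        | succ c =>
          simp only [List.take_succ_cons, List.cons.injEq] at ht
          obtain ⟨rfl, ht⟩ := ht
          refine Or.inr ⟨rfl, by simpa using hne, c, by simpa using hc, ht, ?_⟩
          rcases h with h | ⟨h1, h2, h⟩
          · exact Or.inl (by simpa using h)
          · exact Or.inr ⟨by simpa using h1, by simpa using h2, by simpa using h⟩

theorem vlt_iff {p q : List ℕ} :
    vlt p q ↔ p.sum < q.sum ∨ (p.sum = q.sum ∧ dfsLt p q) := by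
  rw [vlt, dfsLt_iff_exists_take]
  constructor
  · rintro ⟨hne, h | ⟨h, h'⟩⟩
    exacts [Or.inl h, Or.inr ⟨h, hne, h'⟩]
  · rintro (h | ⟨h, hne, h'⟩)
    · exact ⟨fun e => by simp [e] at h, Or.inl h⟩
    · exact ⟨hne, Or.inr ⟨h, h'⟩⟩

theorem vlt_irrefl (p : List ℕ) : ¬ vlt p p := fun h => h.1 rfl

theorem vlt_trans {p q r : List ℕ} (h : vlt p q) (h' : vlt q r) : vlt p r := by
  rw [vlt_iff] at *
  rcases h with h | ⟨h, hd⟩ <;> rcases h' with h' | ⟨h', hd'⟩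
  · exact Or.inl (h.trans h')
  · exact Or.inl (h' ▸ h)
  · exact Or.inl (h ▸ h')
  · exact Or.inr ⟨h.trans h', dfsLt_trans hd hd'⟩

theorem vlt_trichotomy (p q : List ℕ) : vlt p q ∨ p = q ∨ vlt q p := by
  simp only [vlt_iff]
  rcases lt_trichotomy p.sum q.sum with h | h | h
  · exact Or.inl (Or.inl h)
  · rcases dfsLt_trichotomy p q with h' | h' | h'
    · exact Or.inl (Or.inr ⟨h, h'⟩)
    · exact Or.inr (Or.inl h')
    · exact Or.inr (Or.inr (Or.inr ⟨h.symm, h'⟩))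
  · exact Or.inr (Or.inr (Or.inl h))

theorem not_vlt_iff {p q : List ℕ} : ¬ vlt p q ↔ vge p q := by
  constructor
  · intro h
    rcases vlt_trichotomy p q with h' | h' | h'
    exacts [absurd h' h, Or.inr h', Or.inl h']
  · rintro (h | rfl) h'
    exacts [vlt_irrefl _ (vlt_trans h h'), vlt_irrefl _ h']

theorem not_vge_iff {p q : List ℕ} : ¬ vge p q ↔ vlt p q := by
  rw [← not_vlt_iff, not_not]

theorem vge_refl (p : List ℕ) : vge p p := Or.inr rfl

theorem vge_trans {p q r : List ℕ} (h : vge p q) (h' : vge q r) : vge p r := by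
  rcases h with h | rfl
  · rcases h' with h' | rfl
    exacts [Or.inl (vlt_trans h' h), Or.inl h]
  · exact h'

theorem vge_antisymm {p q : List ℕ} (h : vge p q) (h' : vge q p) : p = q := by
  rcases h with h | h
  · exact absurd h (not_vlt_iff.2 h')
  · exact h

theorem vge_iff {p q : List ℕ} :
    vge p q ↔ q.sum < p.sum ∨ (q.sum = p.sum ∧ (dfsLt q p ∨ p = q)) := by
  rw [vge, vlt_iff]
  constructor
  · rintro ((h | ⟨h, h'⟩) | rfl)
    exacts [Or.inl h, Or.inr ⟨h, Or.inl h'⟩, Or.inr ⟨rfl, Or.inr rfl⟩]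
  · rintro (h | ⟨h, h' | h'⟩)
    exacts [Or.inl (Or.inl h), Or.inl (Or.inr ⟨h, h'⟩), Or.inr h']

theorem vge.sum_le {p q : List ℕ} (h : vge p q) : q.sum ≤ p.sum := by
  rw [vge_iff] at h
  omega

theorem dfsLt_concat_iff {P Q : List ℕ} {s t : ℕ} (hst : s ≤ t) (hne : P ≠ Q)
    (hsum : P.sum + s = Q.sum + t) :
    dfsLt (Q ++ [t]) (P ++ [s]) ↔ dfsLt (Q ++ [t - s]) P ∨ P = Q ++ [t - s] := by
  induction Q generalizing P with
  | nil =>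
    cases P with
    | nil => exact absurd rfl hne
    | cons a P =>
      simp only [List.nil_append, List.cons_append, dfsLt_cons_cons, List.cons.injEq]
      simp only [List.sum_cons, List.sum_nil] at hsum
      refine iff_of_true ?_ ?_
      · rcases Nat.lt_or_ge a t with h | h
        · exact Or.inl h
        · exact Or.inr ⟨by omega, dfsLt_nil_iff.2 (by simp)⟩
      · rcases Nat.lt_or_ge a (t - s) with h | h
        · exact Or.inl (Or.inl h)
        · have : a = t - s := by omega
          subst this
          by_cases hP : P = []
          · simp [hP]
          · exact Or.inl (Or.inr ⟨rfl, dfsLt_nil_iff.2 hP⟩)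
  | cons b Q ih =>
    cases P with
    | nil =>
      simp only [List.nil_append, List.cons_append, dfsLt_cons_cons, not_dfsLt_nil, and_false,
        or_false, reduceCtorEq, iff_false, List.sum_cons, List.sum_nil] at *
      omega
    | cons a P =>
      simp only [List.cons_append, dfsLt_cons_cons, List.cons.injEq]
      rcases lt_trichotomy a b with h | rfl | h
      · simp [h]
      · simp only [lt_irrefl, true_and, false_or]
        exact ih (by simpa using hne) (by simp only [List.sum_cons] at hsum; omega)
      · have h1 : ¬ a < b := by omega
        have h2 : ¬ b = a := by omega
        have h3 : ¬ a = b := by omega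
        simp [h1, h2, h3]

theorem vlt_concat_iff {P Q : List ℕ} {s t : ℕ} (hst : s ≤ t) (hne : P = Q → s ≠ t) :
    vlt (Q ++ [t]) (P ++ [s]) ↔ vge P (Q ++ [t - s]) := by
  rw [vlt_iff, vge_iff]
  simp only [List.sum_append, List.sum_cons, List.sum_nil, add_zero]
  rcases lt_trichotomy (P.sum + s) (Q.sum + t) with h | h | h
  · have : ¬ Q.sum + t < P.sum + s := by omega
    have : ¬ Q.sum + t = P.sum + s := by omega
    have : ¬ Q.sum + (t - s) < P.sum := by omega
    have : ¬ Q.sum + (t - s) = P.sum := by omega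
    simp [*]
  · have hPQ : P ≠ Q := by
      rintro rfl
      exact hne rfl (by omega)
    have h' : Q.sum + (t - s) = P.sum := by omega
    simp only [h', h, dfsLt_concat_iff hst hPQ h, lt_irrefl, true_and, false_or]
  · have : Q.sum + t < P.sum + s := by omega
    have : Q.sum + (t - s) < P.sum := by omega
    simp [*]

theorem vge_concat_iff {P Q : List ℕ} {s t : ℕ} (hst : s ≤ t) (hne : P = Q → s ≠ t) :
    vge (P ++ [s]) (Q ++ [t]) ↔ vge P (Q ++ [t - s]) := by
  rw [← vlt_concat_iff hst hne, vge, or_iff_left]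
  intro h
  have := List.append_inj' h rfl
  exact hne this.1 (by simpa using this.2)

theorem vge_concat_iff_not {P Q : List ℕ} {s t : ℕ} (hst : t ≤ s) (hne : P = Q → s ≠ t) :
    vge (P ++ [s]) (Q ++ [t]) ↔ ¬ vge Q (P ++ [s - t]) := by
  rw [← not_vlt_iff, vlt_concat_iff hst (fun h => (hne h.symm).symm)]

theorem vge_concat_self {P : List ℕ} {s : ℕ} : vge (P ++ [s]) P := by
  rw [vge_iff]
  rcases Nat.eq_zero_or_pos s with rfl | hs
  · exact Or.inr ⟨by simp, Or.inl (dfsLt_append (by simp))⟩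
  · exact Or.inl (by simp; omega)

theorem not_vge_self_concat {P : List ℕ} {s : ℕ} : ¬ vge P (P ++ [s]) := by
  intro h
  have := vge_antisymm h vge_concat_self
  simp at this

theorem not_vge_nil_concat {Q : List ℕ} {s : ℕ} : ¬ vge [] (Q ++ [s]) := by
  rw [vge_iff]
  simp

variable {m n : ℕ}

theorem hyp_swap (i j : Fin n) (s : ℝ) : hyp n i j s = hyp n j i (-s) := by
  ext x
  simp only [hyp, Set.mem_ofPred_eq]
  constructor <;> intro h <;> linarith

theorem hyp_eq_cases {i j k l : Fin n} {s t : ℝ} (hkl : k ≠ l) (h : hyp n i j s = hyp n k l t) :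
    (i = k ∧ j = l ∧ s = t) ∨ (i = l ∧ j = k ∧ s = -t) := by
  have key : ∀ x : Fin n → ℝ, x i - x j = s ↔ x k - x l = t := fun x => by
    have := congrArg (x ∈ ·) h
    simpa [hyp] using this
  have hij : i ≠ j := by
    rintro rfl
    have h1 := (key (Pi.single k t)).2 (by simp [hkl.symm])
    have h2 := (key (Pi.single k (t + 1))).1 (by simpa using h1)
    simp [hkl.symm] at h2
  have h0 : (Pi.single k t : Fin n → ℝ) k - (Pi.single k t : Fin n → ℝ) l = t := by
    simp [hkl.symm]
  have hi : i = k ∨ i = l := by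
    by_contra hc
    push Not at hc
    have h1 := (key _).2 h0
    have h2 := (key (Function.update (Pi.single k t) i ((Pi.single k t : Fin n → ℝ) i + 1))).2
      (by rw [Function.update_of_ne hc.1.symm, Function.update_of_ne hc.2.symm]; exact h0)
    rw [Function.update_self, Function.update_of_ne hij.symm] at h2
    linarith
  have hj : j = k ∨ j = l := by
    by_contra hc
    push Not at hc
    have h1 := (key _).2 h0
    have h2 := (key (Function.update (Pi.single k t) j ((Pi.single k t : Fin n → ℝ) j + 1))).2
      (by rw [Function.update_of_ne hc.1.symm, Function.update_of_ne hc.2.symm]; exact h0)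
    rw [Function.update_self, Function.update_of_ne hij] at h2
    linarith
  have h1 := (key _).2 h0
  rcases hi with rfl | rfl <;> rcases hj with rfl | rfl
  · exact absurd rfl hij
  · exact Or.inl ⟨rfl, rfl, by linarith⟩
  · exact Or.inr ⟨rfl, rfl, by linarith⟩
  · exact absurd rfl hij

theorem hyp_mem_shiArr_iff {i j : Fin n} {s : ℤ} :
    hyp n i j (s : ℝ) ∈ shiArr m n ↔
      (i < j ∧ -(m : ℤ) < s ∧ s ≤ m) ∨ (j < i ∧ -(m : ℤ) ≤ s ∧ s < m) := by
  constructor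
  · rintro ⟨k, l, t, hkl, ht, h⟩
    obtain ⟨ht1, ht2⟩ := ht
    rcases hyp_eq_cases hkl.ne h with ⟨rfl, rfl, e⟩ | ⟨rfl, rfl, e⟩
    · have e : s = t := by exact_mod_cast e
      exact Or.inl ⟨hkl, by omega, by omega⟩
    · have e : s = -t := by exact_mod_cast e
      exact Or.inr ⟨hkl, by omega, by omega⟩
  · rintro (⟨h, h1, h2⟩ | ⟨h, h1, h2⟩)
    · exact ⟨i, j, s, h, ⟨by omega, by omega⟩, rfl⟩
    · exact ⟨j, i, -s, h, ⟨by omega, by omega⟩, by rw [hyp_swap]; push_cast; rfl⟩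

theorem trIdxA_shi_iff {i j : Fin n} {s : ℕ} :
    TrIdxA m n (shiArr m n) i j s ↔ (i < j ∧ 0 < s ∧ s ≤ m) ∨ (j < i ∧ s < m) := by
  have := hyp_mem_shiArr_iff (m := m) (i := i) (j := j) (s := s)
  rw [Int.cast_natCast] at this
  rw [TrIdxA, TrIdx, this]
  constructor
  · rintro ⟨⟨h1, h2, h3⟩, h | h⟩
    · refine Or.inl ⟨h.1, ?_, h1⟩
      rcases h3 with h3 | h3
      exacts [h3, absurd h3 h.1.not_gt]
    · exact Or.inr ⟨h.1, by omega⟩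
  · rintro (⟨h1, h2, h3⟩ | ⟨h1, h2⟩)
    · exact ⟨⟨h3, h1.ne, Or.inl h2⟩, Or.inl ⟨h1, by omega, by omega⟩⟩
    · exact ⟨⟨h2.le, h1.ne', Or.inr h1⟩, Or.inr ⟨h1, by omega, by omega⟩⟩

namespace LTree

theorem IsChild.ne {T : LTree m n} {i j : Fin n} {s : ℕ} (h : T.IsChild i j s) : i ≠ j := by
  rintro rfl
  simp [IsChild] at h

theorem IsChild.parent_eq {T : LTree m n} {i j k : Fin n} {s t : ℕ} (h : T.IsChild i j s)
    (h' : T.IsChild i k t) : j = k ∧ s = t := by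
  have := List.append_inj' (h.symm.trans h') rfl
  exact ⟨T.inj this.1, by simpa using this.2⟩

theorem IsChild.child_eq {T : LTree m n} {i i' j : Fin n} {s : ℕ} (h : T.IsChild i j s)
    (h' : T.IsChild i' j s) : i = i' := T.inj (h.trans h'.symm)

theorem IsChild.le {T : LTree m n} {i j : Fin n} {s : ℕ} (h : T.IsChild i j s) : s ≤ m :=
  T.entry_le i s (by rw [h]; simp)

theorem IsCadet.eq {T : LTree m n} {i i' j : Fin n} {s s' : ℕ} (h : T.IsCadet i j s)
    (h' : T.IsCadet i' j s') : i = i' := by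
  rcases lt_trichotomy s s' with hs | rfl | hs
  · exact absurd ⟨i', h'.1⟩ (h.2 s' hs h'.1.le)
  · exact h.1.child_eq h'.1
  · exact absurd ⟨i, h.1⟩ (h'.2 s hs h.1.le)

theorem exists_isChild (T : LTree m n) {i : Fin n} (h : T.path i ≠ []) :
    ∃ j s, T.IsChild i j s := by
  obtain ⟨j, hj⟩ := T.parent_closed i h
  exact ⟨j, (T.path i).getLast h, by rw [IsChild, hj, List.dropLast_append_getLast]⟩

theorem IsChild.length_lt {T : LTree m n} {i j : Fin n} {s : ℕ} (h : T.IsChild i j s) :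
    (T.path j).length < (T.path i).length := by
  rw [h]
  simp

theorem IsChild.drift_eq {T : LTree m n} {i j : Fin n} {s : ℕ} (h : T.IsChild i j s) :
    T.drift i = T.drift j + s := by
  simp [drift, show T.path i = T.path j ++ [s] from h]

end LTree

/-- `i` is reached from `j` by descending along marked edges. -/
def MarkedDesc (T : LTree m n) (μ : Set (Fin n)) : Fin n → Fin n → Prop :=
  Relation.ReflTransGen (fun b a => a ∈ μ ∧ ∃ s, T.IsChild a b s)

theorem IsMarking.isCadet {T : LTree m n} {μ : Set (Fin n)} (hμ : IsMarking T μ) {i j : Fin n}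
    {s : ℕ} (hi : i ∈ μ) (h : T.IsChild i j s) : T.IsCadet i j s ∧ (s = 0 → j < i) := by
  obtain ⟨k, t, hc, hlt⟩ := hμ i hi
  obtain ⟨rfl, rfl⟩ := h.parent_eq hc.1
  exact ⟨hc, hlt⟩

theorem simMu_symm {T : LTree m n} {μ : Set (Fin n)} {i j : Fin n} (h : simMu T μ i j) :
    simMu T μ j i := by
  induction h with
  | refl => exact Relation.ReflTransGen.refl
  | tail _ h ih => exact Relation.ReflTransGen.head h.symm ih

theorem MarkedDesc.simMu {T : LTree m n} {μ : Set (Fin n)} {i j : Fin n}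
    (h : MarkedDesc T μ i j) : simMu T μ i j := by
  induction h with
  | refl => exact Relation.ReflTransGen.refl
  | tail _ h ih => exact Relation.ReflTransGen.tail ih (Or.inr h)

/-- A block of a marked tree is a descending chain. -/
theorem simMu.markedDesc {T : LTree m n} {μ : Set (Fin n)} (hμ : IsMarking T μ) {i j : Fin n}
    (h : simMu T μ i j) : MarkedDesc T μ i j ∨ MarkedDesc T μ j i := by
  induction h with
  | refl => exact Or.inl Relation.ReflTransGen.refl
  | tail _ h ih =>
    rcases h with ⟨ha, s, hs⟩ | ⟨hb, s, hs⟩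
    · rcases ih with ih | ih
      · rcases Relation.ReflTransGen.cases_tail ih with rfl | ⟨c, hc, -, t, ht⟩
        · exact Or.inr (Relation.ReflTransGen.single ⟨ha, s, hs⟩)
        · obtain ⟨rfl, -⟩ := hs.parent_eq ht
          exact Or.inl hc
      · exact Or.inr (Relation.ReflTransGen.head ⟨ha, s, hs⟩ ih)
    · rcases ih with ih | ih
      · exact Or.inl (Relation.ReflTransGen.tail ih ⟨hb, s, hs⟩)
      · rcases Relation.ReflTransGen.cases_head ih with rfl | ⟨c, ⟨hc, t, ht⟩, h'⟩
        · exact Or.inl (Relation.ReflTransGen.single ⟨hb, s, hs⟩)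
        · obtain rfl := (hμ.isCadet hb hs).1.eq (hμ.isCadet hc ht).1
          exact Or.inr h'

theorem MarkedDesc.exists_path {T : LTree m n} {μ : Set (Fin n)} (hμ : IsMarking T μ)
    {i j : Fin n} (h : MarkedDesc T μ j i) :
    ∃ r, T.path i = T.path j ++ r ∧ (r.sum = 0 → j ≤ i) := by
  induction h with
  | refl => exact ⟨[], by simp⟩
  | tail _ h ih =>
    obtain ⟨ha, s, hs⟩ := h
    obtain ⟨r, hr, hle⟩ := ih
    refine ⟨r ++ [s], by rw [hs, hr, List.append_assoc], fun h0 => ?_⟩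
    simp only [List.sum_append, List.sum_cons, List.sum_nil] at h0
    exact (hle (by omega)).trans ((hμ.isCadet ha hs).2 (by omega)).le

theorem MarkedDesc.drift_le {T : LTree m n} {μ : Set (Fin n)} (hμ : IsMarking T μ)
    {i j : Fin n} (h : MarkedDesc T μ j i) :
    T.drift j ≤ T.drift i ∧ (T.drift i = T.drift j → j ≤ i) := by
  obtain ⟨r, hr, hle⟩ := h.exists_path hμ
  have : T.drift i = T.drift j + r.sum := by simp [LTree.drift, hr]
  exact ⟨by omega, fun h => hle (by omega)⟩

/-- Along the edge from `j` to `m`-child `i`, with `j < i`, no hyperplane of the Shi arrangement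
relates the nodes below the edge to the nodes above it. -/
theorem hyp_drift_not_mem {T : LTree m n} {μ : Set (Fin n)} (hμ : IsMarking T μ)
    {a b i j : Fin n} (hij : T.IsChild i j m) (hlt : j < i) (ha : MarkedDesc T μ i a)
    (hb : MarkedDesc T μ b j) :
    hyp n a b ((T.drift a : ℝ) - (T.drift b : ℝ)) ∉ shiArr m n := by
  intro h
  have e : ((T.drift a : ℝ) - (T.drift b : ℝ)) = (((T.drift a : ℤ) - T.drift b : ℤ) : ℝ) := by
    push_cast; rfl
  rw [e, hyp_mem_shiArr_iff] at h
  have h1 := ha.drift_le hμ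
  have h2 := hb.drift_le hμ
  have h3 := hij.drift_eq
  rcases h with ⟨h, -, h4⟩ | ⟨h, -, h4⟩
  · have h5 := h1.2 (by omega)
    have h6 := h2.2 (by omega)
    exact absurd h (by omega)
  · omega

theorem hyp_drift_mem {T : LTree m n} (hm : 0 < m) (hT : ∀ i j, T.IsChild i j m → i < j)
    {i j : Fin n} {s : ℕ} (h : T.IsChild i j s) :
    hyp n i j ((T.drift i : ℝ) - (T.drift j : ℝ)) ∈ shiArr m n := by
  have e : ((T.drift i : ℝ) - (T.drift j : ℝ)) = ((s : ℤ) : ℝ) := by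
    rw [h.drift_eq]; push_cast; ring
  rw [e, hyp_mem_shiArr_iff]
  have hs := h.le
  rcases lt_or_gt_of_ne h.ne with hl | hl
  · exact Or.inl ⟨hl, by omega, by omega⟩
  · refine Or.inr ⟨hl, by omega, ?_⟩
    rcases hs.lt_or_eq with hs | rfl
    · omega
    · exact absurd (hT i j h) hl.not_gt

theorem OTset_shiArr (hm : 0 < m) :
    OTset m n (shiArr m n) = {p ∈ OTall m n | ∀ i j : Fin n, p.1.IsChild i j m → i < j} := by
  ext ⟨T, μ⟩
  simp only [OTset, Set.mem_ofPred_eq, and_congr_right_iff]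
  intro (hμ : IsMarking T μ)
  constructor
  · rintro ⟨hconn, hcad⟩ i j (hij : T.IsChild i j m)
    by_contra hlt
    have hlt : j < i := lt_of_le_of_ne (not_lt.1 hlt) hij.ne.symm
    have hc : T.IsCadet i j m := ⟨hij, fun t h1 h2 => absurd h1 (by omega)⟩
    by_cases hi : i ∈ μ
    · have hB := hconn _ ⟨i, rfl⟩ i Relation.ReflTransGen.refl j
        (MarkedDesc.simMu (Relation.ReflTransGen.single ⟨hi, m, hij⟩) |> simMu_symm)
      have : ∀ c, Relation.ReflTransGen (fun a b => a ∈ {k | simMu T μ i k} ∧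
          b ∈ {k | simMu T μ i k} ∧
          hyp n a b ((T.drift a : ℝ) - (T.drift b : ℝ)) ∈ shiArr m n) i c →
          MarkedDesc T μ i c := by
        intro c h
        induction h with
        | refl => exact Relation.ReflTransGen.refl
        | tail _ h ih =>
          obtain ⟨-, hb, hA⟩ := h
          rcases simMu.markedDesc hμ hb with hb | hb
          · exact hb
          · rcases Relation.ReflTransGen.cases_tail hb with rfl | ⟨c, hc, -, t, ht⟩
            · exact Relation.ReflTransGen.refl
            · obtain ⟨rfl, -⟩ := hij.parent_eq ht
              exact absurd hA (hyp_drift_not_mem hμ hij hlt ih hc)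
      have := (this j hB).drift_le hμ
      have := LTree.IsChild.drift_eq (T := T) hij
      omega
    · rcases hcad i j m hc hi with ⟨h, -⟩ | ⟨a, b, ha, hb, hA⟩
      · omega
      · refine hyp_drift_not_mem hμ hij hlt ?_ ?_ hA
        · rcases simMu.markedDesc hμ ha with ha | ha
          · rcases Relation.ReflTransGen.cases_tail ha with rfl | ⟨c, -, h, -⟩
            · exact Relation.ReflTransGen.refl
            · exact absurd h hi
          · exact ha
        · rcases simMu.markedDesc hμ hb with hb | hb
          · exact hb
          · rcases Relation.ReflTransGen.cases_head hb with rfl | ⟨c, ⟨h, t, ht⟩, -⟩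
            · exact Relation.ReflTransGen.refl
            · obtain rfl := hc.eq (hμ.isCadet h ht).1
              exact absurd h hi
  · intro hT
    refine ⟨?_, fun i j s h _ => Or.inr ⟨i, j, Relation.ReflTransGen.refl,
      Relation.ReflTransGen.refl, hyp_drift_mem hm hT h.1⟩⟩
    rintro B ⟨c, rfl⟩ i hi j hj
    have hij : simMu T μ i j := (simMu_symm hi).trans hj
    clear hj
    induction hij with
    | refl => exact Relation.ReflTransGen.refl
    | tail h1 h2 ih =>
      refine ih.tail ⟨Relation.ReflTransGen.trans hi h1,
        (Relation.ReflTransGen.trans hi h1).tail h2, ?_⟩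
      rcases h2 with ⟨-, s, hs⟩ | ⟨-, s, hs⟩
      · exact hyp_drift_mem hm hT hs
      · rw [hyp_swap, neg_sub]
        exact hyp_drift_mem hm hT hs

theorem LTree.exists_prefix (T : LTree m n) {u : Fin n} {q r : List ℕ}
    (h : T.path u = q ++ r) : ∃ w, T.path w = q := by
  induction r using List.reverseRecOn generalizing u with
  | nil => exact ⟨u, by simpa using h⟩
  | append_singleton r a ih =>
    obtain ⟨w, hw⟩ := T.parent_closed u (by rw [h]; simp)
    refine ih (u := w) ?_
    rw [hw, h, ← List.append_assoc, List.dropLast_concat]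

theorem dfsLt_concat_cases {p K : List ℕ} {s : ℕ} (h : dfsLt p (K ++ [s])) :
    dfsLt p K ∨ p = K ∨ ∃ t r, s < t ∧ p = K ++ t :: r := by
  induction K generalizing p with
  | nil =>
    cases p with
    | nil => simp
    | cons a p =>
      rw [List.nil_append, dfsLt_cons_cons] at h
      rcases h with h | ⟨-, h⟩
      · exact Or.inr (Or.inr ⟨a, p, h, rfl⟩)
      · exact absurd h not_dfsLt_nil
  | cons b K ih =>
    cases p with
    | nil => exact Or.inl List.Lex.nil
    | cons a p =>
      rw [List.cons_append, dfsLt_cons_cons] at h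
      rcases h with h | ⟨rfl, h⟩
      · exact Or.inl (List.Lex.rel h)
      · rcases ih h with h | rfl | ⟨t, r, ht, rfl⟩
        · exact Or.inl (List.Lex.cons h)
        · exact Or.inr (Or.inl rfl)
        · exact Or.inr (Or.inr ⟨t, r, ht, rfl⟩)

/-- A cadet is the immediate successor of its parent in the depth-first order. -/
theorem LTree.IsCadet.dfsLt_cases {T : LTree m n} {i j u : Fin n} {s : ℕ} (h : T.IsCadet i j s)
    (hu : dfsLt (T.path u) (T.path i)) : dfsLt (T.path u) (T.path j) ∨ u = j := by
  rw [h.1] at hu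
  rcases dfsLt_concat_cases hu with hu | hu | ⟨t, r, ht, hu⟩
  · exact Or.inl hu
  · exact Or.inr (T.inj hu)
  · obtain ⟨w, hw⟩ := T.exists_prefix (u := u) (q := T.path j ++ [t]) (r := r) (by simp [hu])
    exact absurd ⟨w, hw⟩ (h.2 t ht (T.entry_le u t (by simp [hu])))

theorem LTree.IsChild.dfsLt {T : LTree m n} {i j : Fin n} {s : ℕ} (h : T.IsChild i j s) :
    dfsLt (T.path j) (T.path i) := by
  rw [h]
  exact dfsLt_append (by simp)

theorem markedDesc_of_forall_mem {T : LTree m n} {μ : Set (Fin n)} (hμ : IsMarking T μ)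
    {i j : Fin n} (hij : dfsLt (T.path i) (T.path j))
    (h : ∀ u, dfsLt (T.path i) (T.path u) → (dfsLt (T.path u) (T.path j) ∨ u = j) → u ∈ μ) :
    MarkedDesc T μ i j := by
  induction hl : (T.path j).length using Nat.strong_induction_on generalizing j with
  | _ l ih =>
    have hj := h j hij (Or.inr rfl)
    obtain ⟨k, s, hc, -⟩ := hμ j hj
    have hstep : MarkedDesc T μ k j := Relation.ReflTransGen.single ⟨hj, s, hc.1⟩
    rcases hc.dfsLt_cases hij with hik | rfl
    · refine Relation.ReflTransGen.trans (ih _ (hl ▸ hc.1.length_lt) hik ?_ rfl) hstep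
      intro u hu hu'
      refine h u hu (Or.inl ?_)
      rcases hu' with hu' | rfl
      · exact dfsLt_trans hu' hc.1.dfsLt
      · exact hc.1.dfsLt
    · exact hstep

/-- The number of blocks whose top node is visited not later than `i` in depth-first order. -/
noncomputable def blockRank (T : LTree m n) (μ : Set (Fin n)) (i : Fin n) : ℕ :=
  {u | u ∉ μ ∧ (dfsLt (T.path u) (T.path i) ∨ u = i)}.ncard

theorem blockRank_le (T : LTree m n) (μ : Set (Fin n)) (i : Fin n) : blockRank T μ i ≤ n := by
  have := Set.ncard_le_card {u | u ∉ μ ∧ (dfsLt (T.path u) (T.path i) ∨ u = i)}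
  simpa [blockRank] using this

theorem blockRank_mono {T : LTree m n} {μ : Set (Fin n)} {i j : Fin n}
    (h : dfsLt (T.path i) (T.path j)) : blockRank T μ i ≤ blockRank T μ j := by
  refine Set.ncard_le_ncard ?_ (Set.toFinite _)
  rintro u ⟨hu, hu' | rfl⟩
  · exact ⟨hu, Or.inl (dfsLt_trans hu' h)⟩
  · exact ⟨hu, Or.inl h⟩

theorem blockRank_lt {T : LTree m n} {μ : Set (Fin n)} (hμ : IsMarking T μ) {i j : Fin n}
    (h : dfsLt (T.path i) (T.path j)) (hij : ¬ simMu T μ i j) :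
    blockRank T μ i < blockRank T μ j := by
  have : ¬ ∀ u, dfsLt (T.path i) (T.path u) →
      (dfsLt (T.path u) (T.path j) ∨ u = j) → u ∈ μ :=
    fun hc => hij (markedDesc_of_forall_mem hμ h hc).simMu
  push Not at this
  obtain ⟨u, hu1, hu2, hu3⟩ := this
  refine Set.ncard_lt_ncard ⟨?_, fun hc => ?_⟩ (Set.toFinite _)
  · rintro u ⟨hu, hu' | rfl⟩
    · exact ⟨hu, Or.inl (dfsLt_trans hu' h)⟩
    · exact ⟨hu, Or.inl h⟩
  · obtain ⟨-, h' | rfl⟩ := hc ⟨hu3, hu2⟩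
    · exact dfsLt_irrefl _ (dfsLt_trans hu1 h')
    · exact dfsLt_irrefl _ hu1

theorem blockRank_eq {T : LTree m n} {μ : Set (Fin n)} (hμ : IsMarking T μ) {i j : Fin n} {s : ℕ}
    (hi : i ∈ μ) (h : T.IsChild i j s) : blockRank T μ i = blockRank T μ j := by
  refine le_antisymm (Set.ncard_le_ncard ?_ (Set.toFinite _)) (blockRank_mono h.dfsLt)
  rintro u ⟨hu, hu' | rfl⟩
  · exact ⟨hu, (hμ.isCadet hi h).1.dfsLt_cases hu'⟩
  · exact absurd hi hu

theorem dfsLt_of_dfsLt_concat {p q : List ℕ} {s : ℕ} (hsum : p.sum = q.sum + s) (hne : p ≠ q)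
    (h : dfsLt p (q ++ [s])) : dfsLt p q := by
  rcases dfsLt_concat_cases h with h | h | ⟨t, r, ht, rfl⟩
  · exact h
  · exact absurd h hne
  · simp only [List.sum_append, List.sum_cons] at hsum
    omega

/-- A point in the interior of the cell of a marked tree. -/
noncomputable def treePoint (T : LTree m n) (μ : Set (Fin n)) (i : Fin n) : ℝ :=
  T.drift i + (blockRank T μ i : ℝ) / (n + 1)

theorem treePoint_lt {T : LTree m n} {μ : Set (Fin n)} {i j : Fin n} {s : ℕ}
    (h : T.drift i < T.drift j + s ∨
      (T.drift i = T.drift j + s ∧ blockRank T μ i < blockRank T μ j)) :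
    treePoint T μ i - treePoint T μ j < s := by
  have hn : (0 : ℝ) < n + 1 := by positivity
  have key : ((T.drift i : ℝ) - T.drift j - s) * (n + 1) +
      (blockRank T μ i - blockRank T μ j) < 0 := by
    have h1 : (blockRank T μ i : ℝ) ≤ n := by exact_mod_cast blockRank_le T μ i
    have h2 : (0 : ℝ) ≤ blockRank T μ j := by positivity
    rcases h with h | ⟨h, h'⟩
    · have : (T.drift i : ℝ) + 1 ≤ T.drift j + s := by exact_mod_cast h
      nlinarith
    · have e : (T.drift i : ℝ) = T.drift j + s := by exact_mod_cast h
      have : (blockRank T μ i : ℝ) < blockRank T μ j := by exact_mod_cast h'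
      rw [e]
      linarith
  have e : treePoint T μ i - treePoint T μ j - s =
      (((T.drift i : ℝ) - T.drift j - s) * (n + 1) +
        (blockRank T μ i - blockRank T μ j)) / (n + 1) := by
    rw [treePoint, treePoint]
    field_simp
    ring
  have := div_neg_of_neg_of_pos key hn
  linarith

theorem lt_treePoint {T : LTree m n} {μ : Set (Fin n)} {i j : Fin n} {s : ℕ}
    (h : T.drift j + s < T.drift i ∨
      (T.drift i = T.drift j + s ∧ blockRank T μ j < blockRank T μ i)) :
    (s : ℝ) < treePoint T μ i - treePoint T μ j := by
  have hn : (0 : ℝ) < n + 1 := by positivity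
  have key : 0 < ((T.drift i : ℝ) - T.drift j - s) * (n + 1) +
      (blockRank T μ i - blockRank T μ j) := by
    have h1 : (blockRank T μ j : ℝ) ≤ n := by exact_mod_cast blockRank_le T μ j
    have h2 : (0 : ℝ) ≤ blockRank T μ i := by positivity
    rcases h with h | ⟨h, h'⟩
    · have : (T.drift j : ℝ) + s + 1 ≤ T.drift i := by exact_mod_cast h
      nlinarith
    · have e : (T.drift i : ℝ) = T.drift j + s := by exact_mod_cast h
      have : (blockRank T μ j : ℝ) < blockRank T μ i := by exact_mod_cast h'
      rw [e]
      linarith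
  have e : treePoint T μ i - treePoint T μ j - s =
      (((T.drift i : ℝ) - T.drift j - s) * (n + 1) +
        (blockRank T μ i - blockRank T μ j)) / (n + 1) := by
    rw [treePoint, treePoint]
    field_simp
    ring
  have := div_pos key hn
  linarith

theorem treePoint_mem_PhiBar {T : LTree m n} {μ : Set (Fin n)} (hμ : IsMarking T μ)
    (A : Set (Set (Fin n → ℝ))) : treePoint T μ ∈ PhiBar m n A T μ := by
  refine ⟨fun i hi j s h => ?_, fun i j s hTr hij => ⟨fun h => ?_, fun h => ?_⟩⟩
  · rw [treePoint, treePoint, blockRank_eq hμ hi h, h.drift_eq]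
    push_cast
    ring
  · refine treePoint_lt ?_
    rw [vlt_iff] at h
    simp only [List.sum_append, List.sum_cons, List.sum_nil, add_zero] at h
    refine h.imp id fun ⟨h1, h2⟩ => ⟨h1, blockRank_lt hμ ?_ hij⟩
    exact dfsLt_of_dfsLt_concat h1 (fun e => hTr.1.2.1 (T.inj e)) h2
  · refine lt_treePoint ?_
    rw [vge_iff] at h
    simp only [List.sum_append, List.sum_cons, List.sum_nil, add_zero] at h
    refine h.imp id fun ⟨h1, h2⟩ => ⟨h1.symm, blockRank_lt hμ ?_ fun h => hij (simMu_symm h)⟩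
    have h3 : dfsLt (T.path j) (T.path j ++ [s]) := dfsLt_append (by simp)
    rcases h2 with h2 | h2
    · exact dfsLt_trans h3 h2
    · rwa [h2]

/-- The face of the Shi arrangement that contains the point `x`. -/
def shiCell (m n : ℕ) (x : Fin n → ℝ) : Set (Fin n → ℝ) :=
  {y | ∀ i j s, TrIdxA m n (shiArr m n) i j s →
    SignType.sign (y i - y j - (s : ℝ)) = SignType.sign (x i - x j - (s : ℝ))}

theorem mem_shiCell_self (x : Fin n → ℝ) : x ∈ shiCell m n x := fun _ _ _ _ => rfl

theorem exists_trIdxA_of_mem {H : Set (Fin n → ℝ)} (hH : H ∈ shiArr m n) :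
    ∃ i j s, TrIdxA m n (shiArr m n) i j s ∧ H = hyp n i j (s : ℝ) := by
  obtain ⟨i, j, s, hij, ⟨h1, h2⟩, rfl⟩ := hH
  rcases lt_or_ge 0 s with hs | hs
  · lift s to ℕ using hs.le
    exact ⟨i, j, s, trIdxA_shi_iff.2 (Or.inl ⟨hij, by omega, by omega⟩), by simp⟩
  · obtain ⟨t, rfl⟩ : ∃ t : ℕ, s = -(t : ℤ) := ⟨(-s).toNat, by omega⟩
    refine ⟨j, i, t, trIdxA_shi_iff.2 (Or.inr ⟨hij, by omega⟩), ?_⟩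
    rw [hyp_swap]
    simp

theorem trIdxA_eq_of_hyp_eq {i j k l : Fin n} {s t : ℕ} (h : TrIdxA m n (shiArr m n) i j s)
    (h' : TrIdxA m n (shiArr m n) k l t) (e : hyp n i j (s : ℝ) = hyp n k l (t : ℝ)) :
    i = k ∧ j = l ∧ s = t := by
  rcases hyp_eq_cases h'.1.2.1 e with ⟨rfl, rfl, hst⟩ | ⟨rfl, rfl, hst⟩
  · exact ⟨rfl, rfl, by exact_mod_cast hst⟩
  · have hst : ((s + t : ℕ) : ℝ) = 0 := by push_cast; linarith
    have hst : s + t = 0 := by exact_mod_cast hst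
    rw [trIdxA_shi_iff] at h h'
    omega

theorem IsSideOf.exists_sign {i j : Fin n} {s : ℝ} (hij : i ≠ j) {σ : Set (Fin n → ℝ)}
    (h : IsSideOf n σ (hyp n i j s)) :
    ∃ c, σ = {x | SignType.sign (x i - x j - s) = c} := by
  rcases h with rfl | ⟨k, l, t, h, hσ⟩
  · exact ⟨0, by ext x; simp [hyp, sign_eq_zero_iff, sub_eq_zero]⟩
  · rcases hyp_eq_cases hij h.symm with ⟨rfl, rfl, rfl⟩ | ⟨rfl, rfl, rfl⟩
    · rcases hσ with rfl | rfl
      · exact ⟨-1, by ext x; simp [sign_eq_neg_one_iff]⟩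
      · exact ⟨1, by ext x; simp [sign_eq_one_iff]⟩
    · rcases hσ with rfl | rfl
      · refine ⟨1, ?_⟩
        ext x
        simp only [Set.mem_ofPred_eq, sign_eq_one_iff]
        constructor <;> intro h <;> linarith
      · refine ⟨-1, ?_⟩
        ext x
        simp only [Set.mem_ofPred_eq, sign_eq_neg_one_iff]
        constructor <;> intro h <;> linarith

theorem isSideOf_sign (i j : Fin n) (s : ℝ) (c : SignType) :
    IsSideOf n {x | SignType.sign (x i - x j - s) = c} (hyp n i j s) := by
  rcases c.trichotomy with rfl | rfl | rfl
  · exact Or.inr ⟨i, j, s, rfl, Or.inl (by ext x; simp [sign_eq_neg_one_iff])⟩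
  · exact Or.inl (by ext x; simp [hyp, sign_eq_zero_iff, sub_eq_zero])
  · exact Or.inr ⟨i, j, s, rfl, Or.inr (by ext x; simp [sign_eq_one_iff])⟩

theorem isFace_shiArr_iff {F : Set (Fin n → ℝ)} :
    IsFace n (shiArr m n) F ↔ ∃ x, F = shiCell m n x := by
  constructor
  · rintro ⟨⟨x, hx⟩, σ, hσ, rfl⟩
    refine ⟨x, ?_⟩
    simp only [Set.mem_iInter] at hx
    ext y
    simp only [Set.mem_iInter]
    constructor
    · intro hy i j s hTr
      obtain ⟨c, hc⟩ := (hσ _ hTr.2).exists_sign hTr.1.2.1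
      have h1 := hx _ hTr.2
      have h2 := hy _ hTr.2
      rw [hc] at h1 h2
      exact h2.trans h1.symm
    · intro hy H hH
      obtain ⟨i, j, s, hTr, rfl⟩ := exists_trIdxA_of_mem hH
      obtain ⟨c, hc⟩ := (hσ _ hTr.2).exists_sign hTr.1.2.1
      have h1 := hx _ hTr.2
      rw [hc] at h1 ⊢
      exact (hy i j s hTr).trans h1
  · rintro ⟨x, rfl⟩
    refine ⟨⟨x, mem_shiCell_self x⟩, fun H => {y | ∀ i j s, TrIdxA m n (shiArr m n) i j s →
      H = hyp n i j (s : ℝ) → SignType.sign (y i - y j - (s : ℝ)) =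
        SignType.sign (x i - x j - (s : ℝ))}, fun H hH => ?_, ?_⟩
    · obtain ⟨i, j, s, hTr, rfl⟩ := exists_trIdxA_of_mem hH
      convert isSideOf_sign i j (s : ℝ) (SignType.sign (x i - x j - (s : ℝ))) using 1
      ext y
      constructor
      · exact fun h => h i j s hTr rfl
      · intro h k l t hTr' e
        obtain ⟨rfl, rfl, rfl⟩ := trIdxA_eq_of_hyp_eq hTr hTr' e
        exact h
    · ext y
      simp only [Set.mem_iInter]
      constructor
      · exact fun h H _ i j s hTr _ => h i j s hTr
      · exact fun h i j s hTr => h _ hTr.2 i j s hTr rfl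

theorem sub_eq_drift_of_markedDesc {T : LTree m n} {μ : Set (Fin n)} {x : Fin n → ℝ}
    (hx : ∀ i ∈ μ, ∀ j s, T.IsChild i j s → x i - x j = (s : ℝ)) {i j : Fin n}
    (h : MarkedDesc T μ j i) : x i - x j = (T.drift i : ℝ) - T.drift j := by
  induction h with
  | refl => simp
  | tail _ h ih =>
    obtain ⟨ha, s, hs⟩ := h
    have := hx _ ha _ _ hs
    rw [hs.drift_eq]
    push_cast
    linarith

theorem sub_eq_drift_of_simMu {T : LTree m n} {μ : Set (Fin n)} (hμ : IsMarking T μ)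
    {x : Fin n → ℝ} (hx : ∀ i ∈ μ, ∀ j s, T.IsChild i j s → x i - x j = (s : ℝ)) {i j : Fin n}
    (h : simMu T μ i j) : x i - x j = (T.drift i : ℝ) - T.drift j := by
  rcases h.markedDesc hμ with h | h
  · linarith [sub_eq_drift_of_markedDesc hx h]
  · exact sub_eq_drift_of_markedDesc hx h

theorem trIdxA_of_isChild {T : LTree m n} (hm : 0 < m) (hT : ∀ i j, T.IsChild i j m → i < j)
    {i j : Fin n} {s : ℕ} (h : T.IsChild i j s) (hs : s = 0 → j < i) :
    TrIdxA m n (shiArr m n) i j s := by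
  rw [trIdxA_shi_iff]
  have h1 := h.le
  rcases lt_or_gt_of_ne h.ne with hl | hl
  · refine Or.inl ⟨hl, Nat.pos_of_ne_zero fun h0 => (hs h0).not_gt hl, h1⟩
  · refine Or.inr ⟨hl, lt_of_le_of_ne h1 ?_⟩
    rintro rfl
    exact hl.not_gt (hT i j h)

theorem PhiBar_eq_shiCell (hm : 0 < m) {T : LTree m n} {μ : Set (Fin n)} (hμ : IsMarking T μ)
    (hT : ∀ i j, T.IsChild i j m → i < j) {x : Fin n → ℝ}
    (hx : x ∈ PhiBar m n (shiArr m n) T μ) : PhiBar m n (shiArr m n) T μ = shiCell m n x := by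
  ext y
  constructor
  · intro hy i j s hTr
    by_cases hij : simMu T μ i j
    · rw [sub_eq_drift_of_simMu hμ hx.1 hij, sub_eq_drift_of_simMu hμ hy.1 hij]
    · obtain ⟨hx1, hx2⟩ := hx.2 i j s hTr hij
      obtain ⟨hy1, hy2⟩ := hy.2 i j s hTr hij
      by_cases h : vlt (T.path i) (T.path j ++ [s])
      · rw [sign_neg (sub_neg.2 (hx1 h)), sign_neg (sub_neg.2 (hy1 h))]
      · rw [not_vlt_iff] at h
        rw [sign_pos (sub_pos.2 (hx2 h)), sign_pos (sub_pos.2 (hy2 h))]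
  · intro hy
    refine ⟨fun i hi j s h => ?_, fun i j s hTr hij => ⟨fun h => ?_, fun h => ?_⟩⟩
    · have := hy i j s (trIdxA_of_isChild hm hT h (hμ.isCadet hi h).2)
      rw [hx.1 i hi j s h, sub_self, sign_zero, sign_eq_zero_iff] at this
      linarith
    · have := hy i j s hTr
      rw [sign_neg (sub_neg.2 ((hx.2 i j s hTr hij).1 h)), sign_eq_neg_one_iff] at this
      linarith
    · have := hy i j s hTr
      rw [sign_pos (sub_pos.2 ((hx.2 i j s hTr hij).2 h)), sign_eq_one_iff] at this
      linarith

/-- The parent of a node; the root is sent to itself. -/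
noncomputable def LTree.parent (T : LTree m n) (i : Fin n) : Fin n :=
  open Classical in if h : ∃ j s, T.IsChild i j s then h.choose else i

theorem LTree.IsChild.parent {T : LTree m n} {i j : Fin n} {s : ℕ} (h : T.IsChild i j s) :
    T.parent i = j := by
  have hex : ∃ j s, T.IsChild i j s := ⟨j, s, h⟩
  rw [LTree.parent, dif_pos hex]
  obtain ⟨t, ht⟩ := hex.choose_spec
  exact (ht.parent_eq h).1

/-- The differences of a vector along the marked edges. -/
noncomputable def edgeDiff (T : LTree m n) (μ : Set (Fin n)) : (Fin n → ℝ) →ₗ[ℝ] (μ → ℝ) :=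
  LinearMap.pi fun i =>
    (LinearMap.proj (i : Fin n) : (Fin n → ℝ) →ₗ[ℝ] ℝ) - LinearMap.proj (T.parent i)

theorem edgeDiff_apply (T : LTree m n) (μ : Set (Fin n)) (v : Fin n → ℝ) (i : μ) :
    edgeDiff T μ v i = v i - v (T.parent i) := rfl

theorem edgeDiff_surjective {T : LTree m n} {μ : Set (Fin n)} (hμ : IsMarking T μ) :
    Function.Surjective (edgeDiff T μ) := by
  classical
  intro c
  let w : Fin n → ℝ := fun u => if h : u ∈ μ then c ⟨u, h⟩ else 0
  refine ⟨fun i => ∑ u, if T.path u <+: T.path i then w u else 0, ?_⟩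
  ext ⟨i, hi⟩
  obtain ⟨j, s, hc, -⟩ := hμ i hi
  rw [edgeDiff_apply]
  simp only [hc.1.parent, ← Finset.sum_sub_distrib]
  rw [Finset.sum_eq_single i]
  · have : ¬ T.path i <+: T.path j := fun h => by
      have := h.length_le
      have := hc.1.length_lt
      omega
    simp [this, w, hi]
  · intro u _ hu
    have : T.path u <+: T.path i ↔ T.path u <+: T.path j := by
      rw [hc.1, List.prefix_concat_iff, or_iff_right]
      intro h
      exact hu (T.inj (h.trans hc.1.symm))
    simp [this]
  · simp

theorem exists_add_smul_mem_PhiBar {A : Set (Set (Fin n → ℝ))} {T : LTree m n}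
    {μ : Set (Fin n)} {x v : Fin n → ℝ} (hx : x ∈ PhiBar m n A T μ)
    (hv : v ∈ LinearMap.ker (edgeDiff T μ)) :
    ∃ ε : ℝ, 0 < ε ∧ x + ε • v ∈ PhiBar m n A T μ := by
  have hlim : ∀ i j : Fin n, Filter.Tendsto (fun ε : ℝ => (x + ε • v) i - (x + ε • v) j)
      (nhdsWithin 0 (Set.Ioi 0)) (nhds (x i - x j)) := by
    intro i j
    have : Continuous (fun ε : ℝ => (x + ε • v) i - (x + ε • v) j) := by
      simp only [Pi.add_apply, Pi.smul_apply, smul_eq_mul]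
      fun_prop
    have := this.tendsto 0
    simp only [zero_smul, add_zero] at this
    exact this.mono_left nhdsWithin_le_nhds
  have hev : ∀ᶠ ε : ℝ in nhdsWithin 0 (Set.Ioi 0), ∀ i j : Fin n, ∀ s : Fin (m + 1),
      (x i - x j < (s : ℕ) → (x + ε • v) i - (x + ε • v) j < (s : ℕ)) ∧
      (((s : ℕ) : ℝ) < x i - x j → ((s : ℕ) : ℝ) < (x + ε • v) i - (x + ε • v) j) := by
    simp only [Filter.eventually_all]
    intro i j s
    refine Filter.Eventually.and ?_ ?_ <;> rw [Filter.eventually_imp_distrib_left] <;> intro h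
    · exact (hlim i j).eventually_lt_const h
    · exact (hlim i j).eventually_const_lt h
  obtain ⟨ε, hε, hpos⟩ := (hev.and self_mem_nhdsWithin).exists
  refine ⟨ε, hpos, fun i hi j s h => ?_, fun i j s hTr hij => ?_⟩
  · have h0 := congrFun (LinearMap.mem_ker.1 hv) ⟨i, hi⟩
    rw [edgeDiff_apply, Pi.zero_apply] at h0
    simp only [h.parent] at h0
    have h1 : v i = v j := by linarith
    have h2 := hx.1 i hi j s h
    simp only [Pi.add_apply, Pi.smul_apply, smul_eq_mul, h1]
    linarith
  · obtain ⟨h1, h2⟩ := hε i j ⟨s, Nat.lt_succ_of_le hTr.1.1⟩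
    exact ⟨fun h => h1 ((hx.2 i j s hTr hij).1 h), fun h => h2 ((hx.2 i j s hTr hij).2 h)⟩

theorem direction_affineSpan_PhiBar {A : Set (Set (Fin n → ℝ))} {T : LTree m n}
    {μ : Set (Fin n)} (hμ : IsMarking T μ) :
    (affineSpan ℝ (PhiBar m n A T μ)).direction = LinearMap.ker (edgeDiff T μ) := by
  rw [direction_affineSpan]
  apply le_antisymm
  · rw [vectorSpan_def, Submodule.span_le]
    rintro _ ⟨x, hx, y, hy, rfl⟩
    rw [SetLike.mem_coe, LinearMap.mem_ker]
    ext ⟨i, hi⟩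
    obtain ⟨j, s, hc, -⟩ := hμ i hi
    have h1 := hx.1 i hi j s hc.1
    have h2 := hy.1 i hi j s hc.1
    rw [edgeDiff_apply]
    simp only [hc.1.parent, vsub_eq_sub, Pi.sub_apply, Pi.zero_apply]
    linarith
  · intro v hv
    obtain ⟨ε, hε, h⟩ := exists_add_smul_mem_PhiBar (treePoint_mem_PhiBar hμ A) hv
    have h1 := vsub_mem_vectorSpan ℝ h (treePoint_mem_PhiBar hμ A)
    rw [vsub_eq_sub, add_sub_cancel_left] at h1
    have h2 := Submodule.smul_mem _ ε⁻¹ h1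
    rwa [smul_smul, inv_mul_cancel₀ hε.ne', one_smul] at h2

theorem codim_PhiBar {A : Set (Set (Fin n → ℝ))} {T : LTree m n}
    {μ : Set (Fin n)} (hμ : IsMarking T μ) : codim n (PhiBar m n A T μ) = μ.ncard := by
  classical
  rw [codim, direction_affineSpan_PhiBar hμ,
    ((edgeDiff T μ).quotKerEquivOfSurjective (edgeDiff_surjective hμ)).finrank_eq,
    Module.finrank_fintype_fun_eq_card, ← Nat.card_eq_fintype_card, Nat.card_coe_set_eq]

/-- The slot `x j + s` comes weakly before the node `x i`; ties are broken in favour of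
positive `s`, then by labels. -/
def SlotLe (x : Fin n → ℝ) (i j : Fin n) (s : ℕ) : Prop :=
  x j + s < x i ∨ (x i = x j + s ∧ (0 < s ∨ j ≤ i))

/-- The inequality `x j + m ≤ x i` follows from the position of `x` relative to the Shi
arrangement. -/
inductive ForcedLe (m : ℕ) (x : Fin n → ℝ) : Fin n → Fin n → Prop
  | base {i j : Fin n} : i < j → SlotLe x i j m → ForcedLe m x i j
  | via {i j k : Fin n} {s t : ℕ} : 0 < s → 0 < t → s + t = m → SlotLe x i k s →
      SlotLe x k j t → ForcedLe m x i j
  | zero {i j k : Fin n} : SlotLe x i k 0 → ForcedLe m x k j → ForcedLe m x i j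
  | top {i j k : Fin n} : ForcedLe m x i k → SlotLe x k j 0 → ForcedLe m x i j

/-- The order of the node `i` and the slot `(j, s)` in the canonical Catalan region of the Shi
face of `x`. -/
def ShiLe (m : ℕ) (x : Fin n → ℝ) (i j : Fin n) (s : ℕ) : Prop :=
  (s < m ∧ SlotLe x i j s) ∨ (s = m ∧ ForcedLe m x i j)

theorem SlotLe.le {x : Fin n → ℝ} {i j : Fin n} {s : ℕ} (h : SlotLe x i j s) :
    x j + s ≤ x i := by
  rcases h with h | ⟨h, -⟩
  exacts [h.le, h.ge]

theorem slotLe_iff_of_pos {x : Fin n → ℝ} {i j : Fin n} {s : ℕ} (hs : 0 < s) :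
    SlotLe x i j s ↔ x j + s ≤ x i := by
  refine ⟨SlotLe.le, fun h => ?_⟩
  rcases h.lt_or_eq with h | h
  exacts [Or.inl h, Or.inr ⟨h.symm, Or.inl hs⟩]

theorem slotLe_zero_iff {x : Fin n → ℝ} {i j : Fin n} :
    SlotLe x i j 0 ↔ x j < x i ∨ (x i = x j ∧ j ≤ i) := by
  simp [SlotLe]

theorem SlotLe.trans {x : Fin n → ℝ} {i j k : Fin n} {s t : ℕ} (h : SlotLe x i j s)
    (h' : SlotLe x j k t) : SlotLe x i k (s + t) := by
  unfold SlotLe at *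
  push_cast
  rcases h with h | ⟨h, hs⟩
  · left
    rcases h' with h' | ⟨h', -⟩ <;> linarith
  · rcases h' with h' | ⟨h', ht⟩
    · left; linarith
    · refine Or.inr ⟨by linarith, ?_⟩
      rcases hs with hs | hs
      · left; omega
      · rcases ht with ht | ht
        · left; omega
        · exact Or.inr (ht.trans hs)

theorem SlotLe.of_not {x : Fin n → ℝ} {i j k : Fin n} {s t : ℕ} (h : SlotLe x i j s)
    (h' : ¬ SlotLe x i k t) (hts : t ≤ s) : SlotLe x k j (s - t) := by
  have h1 : x i ≤ x k + t := not_lt.1 fun hc => h' (Or.inl hc)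
  rcases hts.lt_or_eq with hlt | rfl
  · rw [slotLe_iff_of_pos (by omega), Nat.cast_sub hts]
    linarith [h.le]
  · rw [Nat.sub_self, slotLe_zero_iff]
    rcases h with h | ⟨h, hs⟩
    · left; linarith
    · rcases h1.lt_or_eq with h1 | h1
      · left; linarith
      · refine Or.inr ⟨by linarith, ?_⟩
        have h2 : ¬ (0 < t ∨ k ≤ i) := fun hc => h' (Or.inr ⟨h1, hc⟩)
        push Not at h2
        rcases hs with hs | hs
        · omega
        · exact hs.trans h2.2.le

theorem ForcedLe.slotLe {x : Fin n → ℝ} {i j : Fin n} (h : ForcedLe m x i j) :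
    SlotLe x i j m := by
  induction h with
  | base _ h => exact h
  | via _ _ h h1 h2 => exact h ▸ h1.trans h2
  | zero h1 _ h2 => simpa using h1.trans h2
  | top _ h2 h1 => simpa using h1.trans h2

theorem ShiLe.slotLe {x : Fin n → ℝ} {i j : Fin n} {s : ℕ} (h : ShiLe m x i j s) :
    SlotLe x i j s := by
  rcases h with ⟨-, h⟩ | ⟨rfl, h⟩
  exacts [h, h.slotLe]

theorem SlotLe.shiLe {x : Fin n → ℝ} {i j : Fin n} {s : ℕ} (h : SlotLe x i j s)
    (hs : s < m ∨ (s = m ∧ i < j)) : ShiLe m x i j s := by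
  rcases hs with hs | ⟨rfl, hs⟩
  exacts [Or.inl ⟨hs, h⟩, Or.inr ⟨rfl, .base hs h⟩]

theorem shiLe_iff_slotLe {x : Fin n → ℝ} {i j : Fin n} {s : ℕ}
    (hs : s < m ∨ (s = m ∧ i < j)) : ShiLe m x i j s ↔ SlotLe x i j s :=
  ⟨ShiLe.slotLe, fun h => h.shiLe hs⟩

theorem shiLe_iff_le {x : Fin n → ℝ} {i j : Fin n} {s : ℕ}
    (h : TrIdxA m n (shiArr m n) i j s) : ShiLe m x i j s ↔ x j + s ≤ x i := by
  rw [trIdxA_shi_iff] at h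
  rw [shiLe_iff_slotLe (by omega)]
  refine ⟨SlotLe.le, fun h1 => h1.lt_or_eq.imp id fun h2 => ⟨h2.symm, ?_⟩⟩
  rcases h with h | h
  exacts [Or.inl h.2.1, Or.inr h.1.le]

/-- A linear order on the slots `(j, s)`, `s ≤ m`, that is invariant under shifts, given by the
comparisons `G i j s` of the slot `(i, 0)` with the slot `(j, s)`. -/
structure IsSlotOrder (m : ℕ) (G : Fin n → Fin n → ℕ → Prop) : Prop where
  refl : ∀ i, G i i 0
  antisymm : ∀ {i j}, G i j 0 → G j i 0 → i = j
  self : ∀ {i s}, G i i s → s = 0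
  trans : ∀ {i j k s t}, G i j s → G j k t → s + t ≤ m → G i k (s + t)
  of_not : ∀ {i j k s t}, G i j s → ¬ G i k t → t ≤ s → s ≤ m → G k j (s - t)

theorem isSlotOrder_shiLe (hm : 0 < m) (x : Fin n → ℝ) : IsSlotOrder m (ShiLe m x) where
  refl i := Or.inl ⟨hm, Or.inr ⟨by simp, Or.inr le_rfl⟩⟩
  antisymm {i j} h1 h2 := by
    have h1 := slotLe_zero_iff.1 h1.slotLe
    have h2 := slotLe_zero_iff.1 h2.slotLe
    rcases h1 with h1 | ⟨h1, h1'⟩ <;> rcases h2 with h2 | ⟨h2, h2'⟩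
    · linarith
    · linarith
    · linarith
    · exact le_antisymm h2' h1'
  self {i s} h := by
    have := h.slotLe.le
    have : (s : ℝ) ≤ 0 := by linarith
    exact_mod_cast le_antisymm this (by positivity)
  trans {i j k s t} h1 h2 hst := by
    rcases hst.lt_or_eq with hlt | he
    · exact Or.inl ⟨hlt, h1.slotLe.trans h2.slotLe⟩
    · refine Or.inr ⟨he, ?_⟩
      rcases Nat.eq_zero_or_pos s with rfl | hs
      · refine .zero h1.slotLe ?_
        rcases h2 with h2 | h2
        · omega
        · exact h2.2
      · rcases Nat.eq_zero_or_pos t with rfl | ht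
        · refine .top ?_ h2.slotLe
          rcases h1 with h1 | h1
          · omega
          · exact h1.2
        · exact .via hs ht he h1.slotLe h2.slotLe
  of_not {i j k s t} h1 h2 hts hsm := by
    rcases hsm.lt_or_eq with hlt | rfl
    · have h3 : ¬ SlotLe x i k t := fun h => h2 (h.shiLe (Or.inl (by omega)))
      exact (h1.slotLe.of_not h3 hts).shiLe (Or.inl (by omega))
    · have h1' : ForcedLe s x i j := by
        rcases h1 with h1 | h1
        · omega
        · exact h1.2
      rcases hts.lt_or_eq with hlt | rfl
      · have h3 : ¬ SlotLe x i k t := fun h => h2 (h.shiLe (Or.inl hlt))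
        rcases Nat.eq_zero_or_pos t with rfl | ht
        · refine Or.inr ⟨by omega, .zero ?_ h1'⟩
          have h4 : SlotLe x i i 0 := Or.inr ⟨by simp, Or.inr le_rfl⟩
          simpa using h4.of_not h3 le_rfl
        · exact (h1.slotLe.of_not h3 hts).shiLe (Or.inl (by omega))
      · rw [Nat.sub_self]
        refine Or.inl ⟨hm, ?_⟩
        by_contra hc
        have h4 : SlotLe x k k 0 := Or.inr ⟨by simp, Or.inr le_rfl⟩
        exact h2 (Or.inr ⟨rfl, h1'.top (by simpa using h4.of_not hc le_rfl)⟩)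

/-- The relation `ShiLe` is read off from the tree order of any marked tree whose cell contains
the point. -/
theorem shiLe_iff_vge_of_trIdxA {T : LTree m n} {μ : Set (Fin n)} (hμ : IsMarking T μ)
    {x : Fin n → ℝ} (hx : x ∈ PhiBar m n (shiArr m n) T μ) {i j : Fin n} {s : ℕ}
    (hTr : TrIdxA m n (shiArr m n) i j s) :
    ShiLe m x i j s ↔ vge (T.path i) (T.path j ++ [s]) := by
  rw [shiLe_iff_le hTr]
  by_cases hij : simMu T μ i j
  · have hd := sub_eq_drift_of_simMu hμ hx.1 hij
    have e : x j + s ≤ x i ↔ T.drift j + s ≤ T.drift i := by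
      rw [← Nat.cast_le (α := ℝ)]
      push_cast
      constructor <;> intro h <;> linarith
    rw [e]
    refine ⟨fun h => ?_, fun h => by simpa [LTree.drift] using h.sum_le⟩
    rw [vge_iff]
    rcases h.lt_or_eq with h | h
    · exact Or.inl (by simpa [LTree.drift] using h)
    · refine Or.inr ⟨by simpa [LTree.drift] using h, ?_⟩
      rcases hij.markedDesc hμ with hd | hd
      · have h1 := hd.drift_le hμ
        have h2 := h1.2 (by omega)
        have h3 := hTr.1.2.2
        have h4 := hTr.1.2.1
        omega
      · obtain ⟨r, hr, -⟩ := hd.exists_path hμ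
        have h1 : T.drift i = T.drift j + r.sum := by simp [LTree.drift, hr]
        cases r with
        | nil => exact absurd (T.inj (by simpa using hr)) hTr.1.2.1
        | cons a r =>
          have h2 : a ≤ s := by rw [List.sum_cons] at h1; omega
          rcases h2.lt_or_eq with h2 | rfl
          · left
            rw [hr]
            exact List.Lex.append_left (fun a b : ℕ => b < a) (List.Lex.rel h2) (T.path j)
          · by_cases h3 : r = []
            · right
              rw [hr, h3]
            · left
              rw [hr, show T.path j ++ a :: r = (T.path j ++ [a]) ++ r by simp]
              exact dfsLt_append h3
  · obtain ⟨h1, h2⟩ := hx.2 i j s hTr hij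
    constructor
    · intro h
      by_contra hc
      linarith [h1 (not_vge_iff.1 hc)]
    · intro h
      linarith [h2 h]

theorem shiLe_iff_vge_of_lt (hm : 0 < m) {T : LTree m n} {μ : Set (Fin n)} (hμ : IsMarking T μ)
    {x : Fin n → ℝ} (hx : x ∈ PhiBar m n (shiArr m n) T μ) {i j : Fin n} {s : ℕ} (hij : i ≠ j)
    (hs : s < m ∨ (s = m ∧ i < j)) :
    ShiLe m x i j s ↔ vge (T.path i) (T.path j ++ [s]) := by
  by_cases hTr : TrIdxA m n (shiArr m n) i j s
  · exact shiLe_iff_vge_of_trIdxA hμ hx hTr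
  · rw [trIdxA_shi_iff] at hTr
    have hs0 : s = 0 := by omega
    have hlt : i < j := by omega
    subst hs0
    have h := shiLe_iff_vge_of_trIdxA hμ hx
      (trIdxA_shi_iff.2 (Or.inr ⟨hlt, hm⟩) : TrIdxA m n (shiArr m n) j i 0)
    have hG := isSlotOrder_shiLe hm x
    have h1 : ShiLe m x i j 0 ↔ ¬ ShiLe m x j i 0 :=
      ⟨fun h h' => hij (hG.antisymm h h'), fun h => hG.of_not (hG.refl j) h le_rfl hm.le⟩
    have hne : T.path i ≠ T.path j := fun h => hij (T.inj h)
    rw [h1, h, ← vge_concat_iff_not (s := 0) (t := 0) le_rfl (fun e => absurd e hne),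
      vge_concat_iff le_rfl (fun e => absurd e hne)]

theorem vge_of_forcedLe (hm : 0 < m) {T : LTree m n} {μ : Set (Fin n)} (hμ : IsMarking T μ)
    {x : Fin n → ℝ} (hx : x ∈ PhiBar m n (shiArr m n) T μ) {i j : Fin n}
    (h : ForcedLe m x i j) : vge (T.path i) (T.path j ++ [m]) := by
  have hpos : ∀ {a b : Fin n} {s : ℕ}, 0 < s → SlotLe x a b s → a ≠ b := by
    rintro a _ s hs h rfl
    have h1 := h.le
    have : (0 : ℝ) < s := by exact_mod_cast hs
    linarith
  have hz : ∀ {a b : Fin n}, SlotLe x a b 0 → a ≠ b → vge (T.path a) (T.path b ++ [0]) :=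
    fun h hne => (shiLe_iff_vge_of_lt hm hμ hx hne (Or.inl hm)).1 (h.shiLe (Or.inl hm))
  induction h with
  | base hlt h =>
    exact (shiLe_iff_vge_of_lt hm hμ hx hlt.ne (Or.inr ⟨rfl, hlt⟩)).1 (h.shiLe (Or.inr ⟨rfl, hlt⟩))
  | @via i j k s t hs ht hst h1 h2 =>
    have h1' := (shiLe_iff_vge_of_lt hm hμ hx (hpos hs h1) (Or.inl (by omega))).1
      (h1.shiLe (Or.inl (by omega)))
    have hkj := hpos ht h2
    have h2' := (shiLe_iff_vge_of_lt hm hμ hx hkj (Or.inl (by omega))).1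
      (h2.shiLe (Or.inl (by omega)))
    refine vge_trans h1' ?_
    rw [vge_concat_iff (by omega) (fun e => absurd (T.inj e) hkj), show m - s = t by omega]
    exact h2'
  | @zero i j k h1 h2 ih =>
    by_cases hik : i = k
    · exact hik ▸ ih
    · exact vge_trans (vge_trans (hz h1 hik) vge_concat_self) ih
  | @top i j k h1 h2 ih =>
    by_cases hkj : k = j
    · exact hkj ▸ ih
    · refine vge_trans ih ?_
      rw [vge_concat_iff le_rfl (fun e => absurd (T.inj e) hkj), Nat.sub_self]
      exact hz h2 hkj

theorem forcedLe_of_vge (hm : 0 < m) {T : LTree m n} {μ : Set (Fin n)} (hμ : IsMarking T μ)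
    (hT : ∀ i j, T.IsChild i j m → i < j)
    {x : Fin n → ℝ} (hx : x ∈ PhiBar m n (shiArr m n) T μ) {i j : Fin n} (hij : i ≠ j)
    (h : vge (T.path i) (T.path j ++ [m])) : ForcedLe m x i j := by
  induction hl : (T.path i).length using Nat.strong_induction_on generalizing i with
  | _ l ih =>
    have hroot : T.path i ≠ [] := fun h0 => by
      have := h.sum_le
      simp [h0] at this
      omega
    obtain ⟨k, t, hc⟩ := T.exists_isChild hroot
    have hik := hc.ne
    have ht := hc.le
    have hvge : vge (T.path i) (T.path k ++ [t]) := by rw [← hc]; exact vge_refl _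
    rcases ht.lt_or_eq with htm | rfl
    · have h1 := ((shiLe_iff_vge_of_lt hm hμ hx hik (Or.inl htm)).2 hvge).slotLe
      have hkj : k ≠ j := by
        rintro rfl
        have := h.sum_le
        have h2 := hc.drift_eq
        simp [LTree.drift] at this h2
        omega
      rw [hc, vge_concat_iff ht (fun e => absurd (T.inj e) hkj)] at h
      rcases Nat.eq_zero_or_pos t with rfl | ht0
      · exact .zero h1 (ih _ (hl ▸ hc.length_lt) hkj h rfl)
      · exact .via ht0 (by omega : 0 < m - t) (by omega) h1
          ((shiLe_iff_vge_of_lt hm hμ hx hkj (Or.inl (by omega))).2 h).slotLe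
    · have hlt := hT i k hc
      have h1 : ForcedLe t x i k := .base hlt
        ((shiLe_iff_vge_of_lt hm hμ hx hik (Or.inr ⟨rfl, hlt⟩)).2 hvge).slotLe
      by_cases hkj : k = j
      · exact hkj ▸ h1
      · rw [hc, vge_concat_iff ht (fun e => absurd (T.inj e) hkj), Nat.sub_self] at h
        exact .top h1 ((shiLe_iff_vge_of_lt hm hμ hx hkj (Or.inl hm)).2 h).slotLe

theorem shiLe_iff_vge (hm : 0 < m) {T : LTree m n} {μ : Set (Fin n)} (hμ : IsMarking T μ)
    (hT : ∀ i j, T.IsChild i j m → i < j)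
    {x : Fin n → ℝ} (hx : x ∈ PhiBar m n (shiArr m n) T μ) {i j : Fin n} {s : ℕ} (hij : i ≠ j)
    (hs : s ≤ m) : ShiLe m x i j s ↔ vge (T.path i) (T.path j ++ [s]) := by
  rcases hs.lt_or_eq with hs | rfl
  · exact shiLe_iff_vge_of_lt hm hμ hx hij (Or.inl hs)
  · constructor
    · rintro (⟨h, -⟩ | ⟨-, h⟩)
      · omega
      · exact vge_of_forcedLe hm hμ hx h
    · exact fun h => Or.inr ⟨rfl, forcedLe_of_vge hm hμ hT hx hij h⟩

/-- A tree is determined by the comparisons of its nodes with the children of other nodes. -/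
theorem LTree.eq_of_vge_iff {T T' : LTree m n}
    (h : ∀ i j s, i ≠ j → s ≤ m →
      (vge (T.path i) (T.path j ++ [s]) ↔ vge (T'.path i) (T'.path j ++ [s]))) : T = T' := by
  have hslot : ∀ j k s t, s ≤ m → t ≤ m → vge (T.path j ++ [s]) (T.path k ++ [t]) →
      vge (T'.path j ++ [s]) (T'.path k ++ [t]) := by
    intro j k s t hs ht hv
    by_cases hjk : j = k
    · subst hjk
      rcases lt_trichotomy s t with hlt | rfl | hlt
      · have := hv.sum_le
        simp at this
        omega
      · exact vge_refl _
      · exact Or.inl (vlt_iff.2 (Or.inl (by simpa using hlt)))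
    · rcases le_total s t with hst | hst
      · rw [vge_concat_iff hst (fun e => absurd (T.inj e) hjk), h j k _ hjk (by omega)] at hv
        rwa [vge_concat_iff hst (fun e => absurd (T'.inj e) hjk)]
      · rw [vge_concat_iff_not hst (fun e => absurd (T.inj e) hjk),
          h k j _ (Ne.symm hjk) (by omega)] at hv
        rwa [vge_concat_iff_not hst (fun e => absurd (T'.inj e) hjk)]
  have hroot : ∀ i, T'.path i = [] → T.path i = [] := by
    intro i h'
    by_contra hc
    obtain ⟨j, s, hj⟩ := T.exists_isChild hc
    have := (h i j s hj.ne hj.le).1 (by rw [← hj]; exact vge_refl _)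
    exact not_vge_nil_concat (h' ▸ this)
  have hchild : ∀ i j s, T.IsChild i j s → T'.IsChild i j s := by
    intro i j s hj
    have hi : T'.path i ≠ [] := fun hc => by
      have := hroot i hc
      rw [hj] at this
      simp at this
    obtain ⟨j', s', hj'⟩ := T'.exists_isChild hi
    have h1 : vge (T.path i) (T.path j' ++ [s']) :=
      (h i j' s' hj'.ne hj'.le).2 (by rw [← hj']; exact vge_refl _)
    have h2 : vge (T'.path i) (T'.path j ++ [s]) :=
      (h i j s hj.ne hj.le).1 (by rw [← hj]; exact vge_refl _)
    rw [hj] at h1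
    exact vge_antisymm h2 (hj' ▸ hslot j j' s s' hj.le hj'.le h1)
  have hpath : ∀ l, ∀ i, (T.path i).length = l → T.path i = T'.path i := by
    intro l
    induction l using Nat.strong_induction_on with
    | _ l ih =>
      intro i hl
      by_cases hi : T.path i = []
      · by_contra hc
        obtain ⟨j, s, hj⟩ := T'.exists_isChild (fun h' => hc (hi.trans h'.symm))
        have := (h i j s hj.ne hj.le).2 (by rw [← hj]; exact vge_refl _)
        exact not_vge_nil_concat (hi ▸ this)
      · obtain ⟨j, s, hj⟩ := T.exists_isChild hi
        rw [hj, hchild i j s hj, ih _ (hl ▸ hj.length_lt) j rfl]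
  exact LTree.ext (funext fun i => hpath _ i rfl)

theorem mem_iff_sub_eq (hm : 0 < m) {T : LTree m n} {μ : Set (Fin n)} (hμ : IsMarking T μ)
    (hT : ∀ i j, T.IsChild i j m → i < j) {x : Fin n → ℝ}
    (hx : x ∈ PhiBar m n (shiArr m n) T μ) {i : Fin n} :
    i ∈ μ ↔ ∃ j s, T.IsChild i j s ∧ (s = 0 → j < i) ∧ x i - x j = s := by
  constructor
  · intro hi
    obtain ⟨j, s, hc, hlt⟩ := hμ i hi
    exact ⟨j, s, hc.1, hlt, hx.1 i hi j s hc.1⟩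
  · rintro ⟨j, s, hc, hlt, he⟩
    by_contra hi
    have hij : ¬ simMu T μ i j := by
      intro h
      rcases h.markedDesc hμ with h | h
      · have := (h.exists_path hμ)
        obtain ⟨r, hr, -⟩ := this
        have h1 := hc.length_lt
        rw [hr, List.length_append] at h1
        omega
      · rcases Relation.ReflTransGen.cases_tail h with rfl | ⟨_, _, h, _⟩
        · exact hc.ne rfl
        · exact hi h
    have := (hx.2 i j s (trIdxA_of_isChild hm hT hc hlt) hij).2 (Or.inr hc)
    linarith

theorem PhiBar_injOn (hm : 0 < m) {T T' : LTree m n} {μ μ' : Set (Fin n)}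
    (hμ : IsMarking T μ) (hμ' : IsMarking T' μ') (hT : ∀ i j, T.IsChild i j m → i < j)
    (hT' : ∀ i j, T'.IsChild i j m → i < j)
    (h : PhiBar m n (shiArr m n) T μ = PhiBar m n (shiArr m n) T' μ') : T = T' ∧ μ = μ' := by
  have hx := treePoint_mem_PhiBar hμ (shiArr m n)
  have hx' := h ▸ hx
  obtain rfl : T = T' := LTree.eq_of_vge_iff fun i j s hij hs => by
    rw [← shiLe_iff_vge hm hμ hT hx hij hs, shiLe_iff_vge hm hμ' hT' hx' hij hs]
  refine ⟨rfl, ?_⟩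
  ext i
  rw [mem_iff_sub_eq hm hμ hT hx, mem_iff_sub_eq hm hμ' hT' hx']

variable {G : Fin n → Fin n → ℕ → Prop}

/-- The slot `p` comes weakly after the slot `q`. -/
def SlotGe (G : Fin n → Fin n → ℕ → Prop) (p q : Fin n × ℕ) : Prop :=
  (p.2 ≤ q.2 ∧ G p.1 q.1 (q.2 - p.2)) ∨ (q.2 < p.2 ∧ ¬ G q.1 p.1 (p.2 - q.2))

theorem slotGe_of_le {a b : Fin n} {s t : ℕ} (h : s ≤ t) :
    SlotGe G (a, s) (b, t) ↔ G a b (t - s) := by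
  simp [SlotGe, h, h.not_gt]

theorem slotGe_of_lt {a b : Fin n} {s t : ℕ} (h : t < s) :
    SlotGe G (a, s) (b, t) ↔ ¬ G b a (s - t) := by
  simp [SlotGe, h, h.not_ge]

theorem IsSlotOrder.total (hG : IsSlotOrder m G) (i j : Fin n) : G i j 0 ∨ G j i 0 := by
  by_cases h : G i j 0
  · exact Or.inl h
  · exact Or.inr (hG.of_not (hG.refl i) h le_rfl (Nat.zero_le m))

theorem IsSlotOrder.slotGe_total (hG : IsSlotOrder m G) (p q : Fin n × ℕ) :
    SlotGe G p q ∨ SlotGe G q p := by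
  obtain ⟨a, s⟩ := p
  obtain ⟨b, t⟩ := q
  rcases lt_trichotomy s t with h | rfl | h
  · rw [slotGe_of_le h.le, slotGe_of_lt h]
    exact em _
  · rw [slotGe_of_le le_rfl, slotGe_of_le le_rfl, Nat.sub_self]
    exact hG.total a b
  · rw [slotGe_of_le h.le, slotGe_of_lt h]
    exact (em _).symm

theorem IsSlotOrder.slotGe_trans (hG : IsSlotOrder m G) {a b c : Fin n} {s t u : ℕ} (hs : s ≤ m)
    (ht : t ≤ m) (hu : u ≤ m) (h1 : SlotGe G (a, s) (b, t)) (h2 : SlotGe G (b, t) (c, u)) :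
    SlotGe G (a, s) (c, u) := by
  rcases le_or_gt s t with hst | hst <;> rcases le_or_gt t u with htu | htu <;>
    rcases le_or_gt s u with hsu | hsu
  · rw [slotGe_of_le hst] at h1
    rw [slotGe_of_le htu] at h2
    rw [slotGe_of_le hsu]
    convert hG.trans h1 h2 (by omega) using 1
    omega
  · omega
  · rw [slotGe_of_le hst] at h1
    rw [slotGe_of_lt htu] at h2
    rw [slotGe_of_le hsu]
    by_contra hc
    refine h2 ?_
    convert hG.of_not h1 hc (by omega) (by omega) using 1
    omega
  · rw [slotGe_of_le hst] at h1
    rw [slotGe_of_lt htu] at h2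
    rw [slotGe_of_lt hsu]
    intro hc
    refine h2 ?_
    convert hG.trans hc h1 (by omega) using 1
    omega
  · rw [slotGe_of_lt hst] at h1
    rw [slotGe_of_le htu] at h2
    rw [slotGe_of_le hsu]
    convert hG.of_not h2 h1 (by omega) (by omega) using 1
    omega
  · rw [slotGe_of_lt hst] at h1
    rw [slotGe_of_le htu] at h2
    rw [slotGe_of_lt hsu]
    intro hc
    refine h1 ?_
    convert hG.trans h2 hc (by omega) using 1
    omega
  · omega
  · rw [slotGe_of_lt hst] at h1
    rw [slotGe_of_lt htu] at h2
    rw [slotGe_of_lt hsu]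
    intro hc
    refine h1 ?_
    convert hG.of_not hc h2 (by omega) (by omega) using 1
    omega

/-- `p` is the last slot before the node `i`. -/
def IsLastSlot (m : ℕ) (G : Fin n → Fin n → ℕ → Prop) (i : Fin n) (p : Fin n × ℕ) : Prop :=
  (p.1 ≠ i ∧ p.2 ≤ m ∧ G i p.1 p.2) ∧
    ∀ k u, k ≠ i → u ≤ m → G i k u → SlotGe G p (k, u)

theorem IsSlotOrder.exists_isLastSlot (hG : IsSlotOrder m G) {i k : Fin n} {u : ℕ} (hk : k ≠ i)
    (hu : u ≤ m) (h : G i k u) : ∃ p, IsLastSlot m G i p := by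
  classical
  let S : Finset (Fin n × ℕ) :=
    (Finset.univ ×ˢ Finset.range (m + 1)).filter fun p => p.1 ≠ i ∧ G i p.1 p.2
  have hS : ∀ p, p ∈ S ↔ p.1 ≠ i ∧ p.2 ≤ m ∧ G i p.1 p.2 := by
    intro p
    simp only [S, Finset.mem_filter, Finset.mem_product, Finset.mem_univ, true_and,
      Finset.mem_range, Nat.lt_succ_iff]
    tauto
  have hmax : ∀ U : Finset (Fin n × ℕ), U.Nonempty → (∀ p ∈ U, p.2 ≤ m) →
      ∃ p ∈ U, ∀ q ∈ U, SlotGe G p q := by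
    intro U hU
    induction hU using Finset.Nonempty.cons_induction with
    | singleton a =>
      intro _
      refine ⟨a, by simp, fun q hq => ?_⟩
      rw [Finset.mem_singleton] at hq
      subst hq
      exact (or_self_iff).1 (hG.slotGe_total q q)
    | cons a U ha hU ih =>
      intro hle
      obtain ⟨p, hp, hpU⟩ := ih fun q hq => hle q (Finset.mem_cons_of_mem hq)
      have hpm := hle p (Finset.mem_cons_of_mem hp)
      have ham := hle a (Finset.mem_cons_self a U)
      rcases hG.slotGe_total p a with h | h
      · refine ⟨p, Finset.mem_cons_of_mem hp, fun q hq => ?_⟩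
        rcases Finset.mem_cons.1 hq with rfl | hq
        exacts [h, hpU q hq]
      · refine ⟨a, Finset.mem_cons_self a U, fun q hq => ?_⟩
        rcases Finset.mem_cons.1 hq with rfl | hq'
        · exact (or_self_iff).1 (hG.slotGe_total q q)
        · exact hG.slotGe_trans ham hpm (hle q hq) h (hpU q hq')
  obtain ⟨p, hp, hpS⟩ := hmax S ⟨(k, u), (hS _).2 ⟨hk, hu, h⟩⟩ fun p hp => ((hS p).1 hp).2.1
  exact ⟨p, (hS p).1 hp, fun k u hk hu h => hpS _ ((hS _).2 ⟨hk, hu, h⟩)⟩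

/-- The last slot before the node `i`, if any. -/
noncomputable def lastSlot (m : ℕ) (G : Fin n → Fin n → ℕ → Prop) (i : Fin n) :
    Option (Fin n × ℕ) :=
  open Classical in if h : ∃ p, IsLastSlot m G i p then some h.choose else none

theorem isLastSlot_of_eq_some {i : Fin n} {p : Fin n × ℕ} (h : lastSlot m G i = some p) :
    IsLastSlot m G i p := by
  unfold lastSlot at h
  split_ifs at h with hex
  exact Option.some.inj h ▸ hex.choose_spec

theorem IsSlotOrder.not_of_lastSlot_eq_none (hG : IsSlotOrder m G) {i k : Fin n} {u : ℕ}
    (h : lastSlot m G i = none) (hk : k ≠ i) (hu : u ≤ m) : ¬ G i k u := by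
  intro hc
  have hex := hG.exists_isLastSlot hk hu hc
  simp [lastSlot, hex] at h

/-- The number of nodes that come weakly before the node `i`. -/
noncomputable def nodeRank (G : Fin n → Fin n → ℕ → Prop) (i : Fin n) : ℕ := {j | G i j 0}.ncard

theorem IsSlotOrder.le_zero (hG : IsSlotOrder m G) {i j : Fin n} {s : ℕ} (hs : s ≤ m)
    (h : G i j s) : G i j 0 := by
  by_contra hc
  have := hG.of_not h hc (Nat.zero_le s) hs
  have := hG.self this
  have hs0 : s = 0 := by omega
  exact hc (hs0 ▸ h)

theorem IsSlotOrder.nodeRank_lt (hG : IsSlotOrder m G) {i j : Fin n} {s : ℕ} (hs : s ≤ m)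
    (hij : j ≠ i) (h : G i j s) : nodeRank G j < nodeRank G i := by
  have h0 := hG.le_zero hs h
  refine Set.ncard_lt_ncard ⟨fun k hk => ?_, fun hc => ?_⟩ (Set.toFinite _)
  · exact hG.trans h0 hk (Nat.zero_le m)
  · exact hij (hG.antisymm (hc (hG.refl i : i ∈ {j | G i j 0})) h0)

/-- The root-to-node path obtained by following the last slots. -/
noncomputable def slotPath (m : ℕ) (G : Fin n → Fin n → ℕ → Prop) (i : Fin n) : List ℕ :=
  open Classical in
  match lastSlot m G i with
  | none => []
  | some p => if nodeRank G p.1 < nodeRank G i then slotPath m G p.1 ++ [p.2] else []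
termination_by nodeRank G i

theorem slotPath_of_none {i : Fin n} (h : lastSlot m G i = none) : slotPath m G i = [] := by
  rw [slotPath, h]

theorem IsSlotOrder.slotPath_of_some (hG : IsSlotOrder m G) {i : Fin n} {p : Fin n × ℕ}
    (h : lastSlot m G i = some p) : slotPath m G i = slotPath m G p.1 ++ [p.2] := by
  obtain ⟨⟨h1, h2, h3⟩, -⟩ := isLastSlot_of_eq_some h
  rw [slotPath, h]
  simp [hG.nodeRank_lt h2 h1 h3]

theorem IsSlotOrder.slotGe_of_lastSlot (hG : IsSlotOrder m G) {i k : Fin n} {u : ℕ}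
    {p : Fin n × ℕ} (h : lastSlot m G i = some p) (hk : k ≠ i) (hu : u ≤ m) :
    G i k u ↔ SlotGe G p (k, u) := by
  obtain ⟨⟨h1, h2, h3⟩, h4⟩ := isLastSlot_of_eq_some h
  refine ⟨h4 k u hk hu, fun h5 => ?_⟩
  have h6 : SlotGe G (i, 0) (p.1, p.2) := (slotGe_of_le (Nat.zero_le _)).2 (by simpa using h3)
  have := hG.slotGe_trans (Nat.zero_le m) h2 hu h6 h5
  simpa using (slotGe_of_le (Nat.zero_le u)).1 this

theorem IsSlotOrder.lastSlot_injective (hG : IsSlotOrder m G) :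
    Function.Injective (lastSlot m G) := by
  have key : ∀ i j, lastSlot m G i = lastSlot m G j → i ≠ j → ¬ G i j 0 := by
    intro i j h hij hc
    rcases hp : lastSlot m G i with _ | p
    · exact hG.not_of_lastSlot_eq_none hp hij.symm (Nat.zero_le m) hc
    · obtain ⟨⟨h1, h2, h3⟩, -⟩ := isLastSlot_of_eq_some (h.symm.trans hp)
      have h4 := (hG.slotGe_of_lastSlot hp hij.symm (Nat.zero_le m)).1 hc
      have h5 : SlotGe G (j, 0) (p.1, p.2) := (slotGe_of_le (Nat.zero_le _)).2 (by simpa using h3)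
      rcases Nat.eq_zero_or_pos p.2 with h0 | h0
      · have h6 := (slotGe_of_le (a := p.1) (s := p.2) (b := j) (t := 0) h0.le).1 h4
        rw [h0] at h3
        exact h1 (hG.antisymm (by simpa using h6) h3)
      · exact (slotGe_of_lt (a := p.1) (s := p.2) (b := j) (t := 0) h0).1 h4 (by simpa using h3)
  intro i j h
  by_contra hij
  rcases hG.total i j with hc | hc
  exacts [key i j h hij hc, key j i h.symm (Ne.symm hij) hc]

theorem IsSlotOrder.slotPath_injective (hG : IsSlotOrder m G) :
    Function.Injective (slotPath m G) := by
  have key : ∀ l, ∀ i j, (slotPath m G i).length = l → slotPath m G i = slotPath m G j → i = j := by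
    intro l
    induction l with
    | zero =>
      intro i j hl h
      have hi : ∀ i, slotPath m G i = [] → lastSlot m G i = none := by
        intro i hi
        rcases hp : lastSlot m G i with _ | p
        · rfl
        · rw [hG.slotPath_of_some hp] at hi
          simp at hi
      have h0 := List.eq_nil_of_length_eq_zero hl
      exact hG.lastSlot_injective ((hi i h0).trans (hi j (h ▸ h0)).symm)
    | succ l ih =>
      intro i j hl h
      rcases hp : lastSlot m G i with _ | p
      · rw [slotPath_of_none hp] at hl
        simp at hl
      · rcases hq : lastSlot m G j with _ | q
        · rw [h, slotPath_of_none hq] at hl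
          simp at hl
        · rw [hG.slotPath_of_some hp, hG.slotPath_of_some hq] at h
          rw [hG.slotPath_of_some hp] at hl
          obtain ⟨h1, h2⟩ := List.append_inj' h rfl
          have h3 : p = q := Prod.ext (ih _ _ (by simpa using hl) h1) (by simpa using h2)
          exact hG.lastSlot_injective (hp.trans (h3 ▸ hq.symm))
  exact fun i j h => key _ i j rfl h

theorem IsSlotOrder.iff_vge_slotPath (hG : IsSlotOrder m G) {j k : Fin n} {u : ℕ} (hjk : j ≠ k)
    (hu : u ≤ m) : G j k u ↔ vge (slotPath m G j) (slotPath m G k ++ [u]) := by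
  induction hN : nodeRank G j + nodeRank G k using Nat.strong_induction_on
    generalizing j k u with
  | _ N ih =>
    rcases hp : lastSlot m G j with _ | ⟨p, s⟩
    · rw [slotPath_of_none hp]
      exact iff_of_false (hG.not_of_lastSlot_eq_none hp hjk.symm hu) not_vge_nil_concat
    · obtain ⟨⟨h1, h2, h3⟩, -⟩ := isLastSlot_of_eq_some hp
      have hlt := hG.nodeRank_lt h2 h1 h3
      rw [hG.slotPath_of_some hp, hG.slotGe_of_lastSlot hp hjk.symm hu]
      simp only at h1 h2 h3 hlt ⊢
      by_cases hpk : p = k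
      · subst hpk
        have e1 : SlotGe G (p, s) (p, u) ↔ u ≤ s := by
          rcases lt_or_ge u s with h | h
          · rw [slotGe_of_lt h]
            refine iff_of_true (fun hc => ?_) h.le
            have := hG.self hc
            omega
          · rw [slotGe_of_le h]
            constructor
            · intro hc
              have := hG.self hc
              omega
            · intro h'
              rw [Nat.sub_eq_zero_of_le h']
              exact hG.refl p
        rw [e1]
        constructor
        · intro h
          rcases h.lt_or_eq with h | rfl
          · exact Or.inl (vlt_iff.2 (Or.inl (by simpa using h)))
          · exact vge_refl _
        · intro h
          simpa using h.sum_le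
      · have hne : slotPath m G p ≠ slotPath m G k := fun e => hpk (hG.slotPath_injective e)
        rcases lt_or_ge u s with h | h
        · rw [slotGe_of_lt h, vge_concat_iff_not h.le fun e => absurd e hne,
            ih _ (by omega) (Ne.symm hpk) (by omega) rfl]
        · rw [slotGe_of_le h, vge_concat_iff h fun e => absurd e hne,
            ih _ (by omega) hpk (by omega) rfl]

/-- The tree of a slot order. -/
noncomputable def IsSlotOrder.toLTree (hG : IsSlotOrder m G) : LTree m n where
  path := slotPath m G
  entry_le v := by
    induction hN : nodeRank G v using Nat.strong_induction_on generalizing v with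
    | _ N ih =>
      intro t ht
      rcases hp : lastSlot m G v with _ | p
      · rw [slotPath_of_none hp] at ht
        simp at ht
      · obtain ⟨⟨h1, h2, h3⟩, -⟩ := isLastSlot_of_eq_some hp
        rw [hG.slotPath_of_some hp, List.mem_append, List.mem_singleton] at ht
        rcases ht with ht | rfl
        · exact ih _ (hN ▸ hG.nodeRank_lt h2 h1 h3) _ rfl t ht
        · exact h2
  inj := hG.slotPath_injective
  parent_closed v hv := by
    rcases hp : lastSlot m G v with _ | p
    · exact absurd (slotPath_of_none hp) hv
    · exact ⟨p.1, by rw [hG.slotPath_of_some hp, List.dropLast_concat]⟩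

section Canonical

variable {x : Fin n → ℝ} {T : LTree m n}

theorem vlt_of_forcedLe (hm : 0 < m)
    (hT : ∀ i j s, i ≠ j → s ≤ m → (ShiLe m x i j s ↔ vge (T.path i) (T.path j ++ [s])))
    {i j : Fin n} (h : ForcedLe m x i j) (hlt : j < i) : vlt (T.path j ++ [m]) (T.path i) := by
  have hpos : ∀ {a b : Fin n} {s : ℕ}, 0 < s → SlotLe x a b s → a ≠ b := by
    rintro a _ s hs h rfl
    have h1 := h.le
    have : (0 : ℝ) < s := by exact_mod_cast hs
    linarith
  have hvlt : ∀ {p q r : List ℕ}, vge p q → vlt r q → vlt r p := by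
    rintro p q r (h | rfl) h'
    exacts [vlt_trans h' h, h']
  induction h with
  | base h => exact absurd h hlt.not_gt
  | @via i j k s t hs ht hst h1 h2 =>
    have hkj := hpos ht h2
    have h1' := (hT i k s (hpos hs h1) (by omega)).1 (h1.shiLe (Or.inl (by omega)))
    have h2' := (hT k j t hkj (by omega)).1 (h2.shiLe (Or.inl (by omega)))
    refine hvlt h1' ?_
    rw [vlt_concat_iff (by omega) (fun e => absurd (T.inj e) hkj), show m - s = t by omega]
    exact h2'
  | @zero i j k h1 h2 ih =>
    by_cases hik : i = k
    · subst hik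
      exact ih hlt
    · have h1' := (hT i k 0 hik (by omega)).1 (h1.shiLe (Or.inl hm))
      have h2' := (hT k j m (hpos hm h2.slotLe) le_rfl).1 (Or.inr ⟨rfl, h2⟩)
      exact hvlt h1' (not_vge_iff.1 fun hc => not_vge_self_concat (vge_trans h2' hc))
  | @top i j k h1 h2 ih =>
    by_cases hkj : k = j
    · subst hkj
      exact ih hlt
    · have h1' := (hT i k m (hpos hm h1.slotLe) le_rfl).1 (Or.inr ⟨rfl, h1⟩)
      have h2' := (hT k j 0 hkj (by omega)).1 (h2.shiLe (Or.inl hm))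
      refine hvlt h1' ?_
      rw [vlt_concat_iff le_rfl (fun e => absurd (T.inj e) hkj), Nat.sub_self]
      exact h2'

theorem lt_of_isChild (hm : 0 < m)
    (hT : ∀ i j s, i ≠ j → s ≤ m → (ShiLe m x i j s ↔ vge (T.path i) (T.path j ++ [s])))
    {i j : Fin n} (h : T.IsChild i j m) : i < j := by
  by_contra hc
  have hlt : j < i := lt_of_le_of_ne (not_lt.1 hc) h.ne.symm
  rcases (hT i j m h.ne le_rfl).2 (Or.inr h) with h1 | h1
  · omega
  · have := vlt_of_forcedLe hm hT h1.2 hlt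
    rw [h] at this
    exact vlt_irrefl _ this

/-- The edges of the tree that are tight at the point `x`. -/
def tightEdges (T : LTree m n) (x : Fin n → ℝ) : Set (Fin n) :=
  {i | ∃ j s, T.IsChild i j s ∧ x i - x j = (s : ℝ)}

theorem isMarking_tightEdges (hm : 0 < m)
    (hT : ∀ i j s, i ≠ j → s ≤ m → (ShiLe m x i j s ↔ vge (T.path i) (T.path j ++ [s]))) :
    IsMarking T (tightEdges T x) := by
  rintro i ⟨j, s, hc, he⟩
  have h0 : s = 0 → j < i := by
    rintro rfl
    have h1 := slotLe_zero_iff.1 ((hT i j 0 hc.ne (by omega)).2 (Or.inr hc)).slotLe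
    push_cast at he
    rcases h1 with h1 | h1
    · linarith
    · exact lt_of_le_of_ne h1.2 hc.ne.symm
  refine ⟨j, s, ⟨hc, ?_⟩, h0⟩
  rintro t hst htm ⟨k, hk⟩
  have h1 := ((hT k j t hk.ne hk.le).2 (Or.inr hk)).slotLe.le
  have h2 : SlotLe x k i (t - s) := by
    rw [slotLe_iff_of_pos (by omega), Nat.cast_sub hst.le]
    linarith
  have h3 : ShiLe m x k i (t - s) := by
    refine h2.shiLe ?_
    rcases Nat.lt_or_ge (t - s) m with h | h
    · exact Or.inl h
    · obtain rfl : t = m := by omega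
      exact Or.inr ⟨by omega, (lt_of_isChild hm hT hk).trans (h0 (by omega))⟩
  have hki : k ≠ i := by
    rintro rfl
    exact hst.ne (hc.parent_eq hk).2
  have h4 := (hT k i (t - s) hki (by omega)).1 h3
  rw [hk, vge_concat_iff_not (by omega) (fun e => absurd (T.inj (e.trans rfl)) hc.ne.symm),
    show t - (t - s) = s by omega, ← hc] at h4
  exact h4 (vge_refl _)

theorem simMu_of_sub_eq (hm : 0 < m)
    (hT : ∀ i j s, i ≠ j → s ≤ m → (ShiLe m x i j s ↔ vge (T.path i) (T.path j ++ [s])))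
    {i j : Fin n} {s : ℕ} (hTr : TrIdxA m n (shiArr m n) i j s) (he : x i = x j + s) :
    simMu T (tightEdges T x) i j := by
  induction hl : (T.path i).length using Nat.strong_induction_on generalizing i s with
  | _ l ih =>
    have hij := hTr.1.2.1
    have hv := (hT i j s hij hTr.1.1).1 ((shiLe_iff_le hTr).2 he.ge)
    obtain ⟨k, t, hc⟩ := T.exists_isChild (i := i) fun h => not_vge_nil_concat (h ▸ hv)
    have hik := ((hT i k t hc.ne hc.le).2 (Or.inr hc)).slotLe
    have hstep : x i = x k + t → simMu T (tightEdges T x) i k := fun h =>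
      Relation.ReflTransGen.single (Or.inl ⟨⟨k, t, hc, by linarith⟩, t, hc⟩)
    have htm := hc.le
    rw [trIdxA_shi_iff] at hTr
    by_cases hkj : k = j
    · subst hkj
      have h1 := hik.le
      have h2 := hv.sum_le
      rw [hc] at h2
      simp only [List.sum_append, List.sum_cons, List.sum_nil, add_zero,
        add_le_add_iff_left] at h2
      have h3 : (s : ℝ) ≤ t := by exact_mod_cast h2
      exact hstep (by linarith)
    · rw [hc] at hv
      rcases le_or_gt t s with hts | hts
      · rw [vge_concat_iff hts (fun e => absurd (T.inj e) hkj),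
          ← hT k j (s - t) hkj (by omega)] at hv
        have h1 := hv.slotLe.le
        rw [Nat.cast_sub hts] at h1
        have h2 := hik.le
        have hk : x k = x j + ((s - t : ℕ) : ℝ) := by
          rw [Nat.cast_sub hts]
          linarith
        have hik' : x i = x k + t := by linarith
        refine (hstep hik').trans (ih _ (hl ▸ hc.length_lt) (trIdxA_shi_iff.2 ?_) hk rfl)
        rcases lt_or_gt_of_ne hkj with hlt | hlt
        · refine Or.inl ⟨hlt, Nat.pos_of_ne_zero fun h0 => ?_, by omega⟩
          have h3 := hv.slotLe
          rw [h0, slotLe_zero_iff] at h3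
          rw [h0] at hk
          push_cast at hk
          rcases h3 with h3 | h3
          · linarith
          · exact h3.2.not_gt hlt
        · refine Or.inr ⟨hlt, ?_⟩
          by_contra hge
          have ht0 : t = 0 := by omega
          subst ht0
          rw [slotLe_zero_iff] at hik
          push_cast at hik'
          rcases hik with h3 | ⟨-, h3⟩
          · linarith
          · omega
      · rw [vge_concat_iff_not hts.le (fun e => absurd (T.inj e) hkj),
          ← hT j k (t - s) (Ne.symm hkj) (by omega)] at hv
        refine absurd (SlotLe.shiLe ?_ ?_) hv
        · rw [slotLe_iff_of_pos (by omega), Nat.cast_sub hts.le]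
          linarith [hik.le]
        · rcases Nat.lt_or_ge (t - s) m with h | h
          · exact Or.inl h
          · obtain rfl : t = m := by omega
            have h3 := lt_of_isChild hm hT hc
            exact Or.inr ⟨by omega, by omega⟩

theorem mem_PhiBar_tightEdges (hm : 0 < m)
    (hT : ∀ i j s, i ≠ j → s ≤ m → (ShiLe m x i j s ↔ vge (T.path i) (T.path j ++ [s]))) :
    x ∈ PhiBar m n (shiArr m n) T (tightEdges T x) := by
  refine ⟨?_, fun i j s hTr hij => ?_⟩
  · rintro i ⟨j, s, hc, he⟩ k t hk
    obtain ⟨rfl, rfl⟩ := hc.parent_eq hk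
    exact he
  · rw [← not_vge_iff, ← hT i j s hTr.1.2.1 hTr.1.1, shiLe_iff_le hTr, not_le]
    refine ⟨fun h => by linarith, fun h => ?_⟩
    rcases h.lt_or_eq with h | h
    · linarith
    · exact absurd (simMu_of_sub_eq hm hT hTr h.symm) hij

end Canonical

theorem exists_mem_PhiBar (hm : 0 < m) (x : Fin n → ℝ) :
    ∃ (T : LTree m n) (μ : Set (Fin n)), IsMarking T μ ∧ (∀ i j, T.IsChild i j m → i < j) ∧
      x ∈ PhiBar m n (shiArr m n) T μ := by
  have hG := isSlotOrder_shiLe hm x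
  have hT : ∀ i j s, i ≠ j → s ≤ m → (ShiLe m x i j s ↔
      vge (hG.toLTree.path i) (hG.toLTree.path j ++ [s])) :=
    fun i j s hij hs => hG.iff_vge_slotPath hij hs
  exact ⟨hG.toLTree, tightEdges hG.toLTree x, isMarking_tightEdges hm hT,
    fun i j h => lt_of_isChild hm hT h, mem_PhiBar_tightEdges hm hT⟩

end Braid

theorem shi_faces (m n : ℕ) (hm : 0 < m) (hn : 0 < n) :
    Braid.OTset m n (Braid.shiArr m n) =
      {p ∈ Braid.OTall m n | ∀ i j : Fin n, p.1.IsChild i j m → i < j} ∧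
    ∀ k : ℕ,
      Set.BijOn
        (fun p : Braid.LTree m n × Set (Fin n) =>
          Braid.PhiBar m n (Braid.shiArr m n) p.1 p.2)
        {p ∈ Braid.OTall m n |
          (∀ i j : Fin n, p.1.IsChild i j m → i < j) ∧ p.2.ncard = k}
        {F | Braid.IsFace n (Braid.shiArr m n) F ∧ Braid.codim n F = k} := by
  refine ⟨Braid.OTset_shiArr hm, fun k => ⟨?_, ?_, ?_⟩⟩
  · rintro ⟨T, μ⟩ ⟨hμ, hT, hk⟩
    exact ⟨Braid.isFace_shiArr_iff.2 ⟨_, Braid.PhiBar_eq_shiCell hm hμ hT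
      (Braid.treePoint_mem_PhiBar hμ _)⟩, (Braid.codim_PhiBar hμ).trans hk⟩
  · rintro ⟨T, μ⟩ ⟨hμ, hT, -⟩ ⟨T', μ'⟩ ⟨hμ', hT', -⟩ h
    obtain ⟨rfl, rfl⟩ := Braid.PhiBar_injOn hm hμ hμ' hT hT' h
    rfl
  · rintro F ⟨hF, hk⟩
    obtain ⟨x, rfl⟩ := Braid.isFace_shiArr_iff.1 hF
    obtain ⟨T, μ, hμ, hT, hx⟩ := Braid.exists_mem_PhiBar hm x
    have hcell := Braid.PhiBar_eq_shiCell hm hμ hT hx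
    exact ⟨(T, μ), ⟨hμ, hT, by rw [← hk, ← hcell, Braid.codim_PhiBar hμ]⟩, hcell⟩
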